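/- Let d = 4 and fix σ ∈ (1, 3/2). There exists ε > 0 (depending on σ) such that for every potential V : ℤ⁴ → ℂ with ‖V‖_{ℓ^{σ}(ℤ⁴)} ≤ ε, every λ ∈ ℂ and every ψ ∈ ℓ²(ℤ⁴) satisfying the stationary discrete Klein–Gordon eigenvalue equation √(1−Δ)ψ + Vψ = λψ, one has ψ = 0. -/

import Mathlib

open MeasureTheory Real
open scoped ENNReal

noncomputable section

/-- Dispersion relation of the discrete Klein--Gordon equation on `ℤ^d`. -/
def omegaKG (d : ℕ) (ξ : Fin d → ℝ) : ℝ :=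
  Real.sqrt (1 + ∑ j : Fin d, 2 * (1 - Real.cos (ξ j)))

/-- The fundamental domain `[0, 2π]^d` of the torus. -/
def cube (d : ℕ) : Set (Fin d → ℝ) := Set.Icc 0 (fun _ => 2 * Real.pi)

/-- The convolution kernel of the Fourier multiplier on `ℤ^d` with symbol `m(ξ)`. -/
def multKernel (d : ℕ) (m : (Fin d → ℝ) → ℝ) (x : Fin d → ℤ) : ℂ :=
  ((((2 * Real.pi) ^ d)⁻¹ : ℝ) : ℂ) *
    ∫ ξ in cube d,
      Complex.exp (Complex.I * ((∑ j : Fin d, (x j : ℝ) * ξ j : ℝ) : ℂ)) * ((m ξ : ℝ) : ℂ)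

/-- The propagator `cos(t√(1−Δ))`, realized as the Fourier multiplier with symbol
`cos(t ω(ξ))`. -/
def cosProp (d : ℕ) (t : ℝ) (f : (Fin d → ℤ) → ℂ) (x : Fin d → ℤ) : ℂ :=
  ∑' y : Fin d → ℤ, multKernel d (fun ξ => Real.cos (t * omegaKG d ξ)) (x - y) * f y

/-- The propagator `sin(t√(1−Δ))/√(1−Δ)`, realized as the Fourier multiplier with symbol
`sin(t ω(ξ))/ω(ξ)`. -/
def sinProp (d : ℕ) (t : ℝ) (f : (Fin d → ℤ) → ℂ) (x : Fin d → ℤ) : ℂ :=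
  ∑' y : Fin d → ℤ, multKernel d (fun ξ => Real.sin (t * omegaKG d ξ) / omegaKG d ξ) (x - y) * f y

/-- The operator `√(1−Δ)`, realized as the Fourier multiplier with symbol `ω(ξ)`. -/
def sqrtOneSubLap (d : ℕ) (f : (Fin d → ℤ) → ℂ) (x : Fin d → ℤ) : ℂ :=
  ∑' y : Fin d → ℤ, multKernel d (omegaKG d) (x - y) * f y

/-- The solution of the inhomogeneous discrete Klein--Gordon equation with data `(f,g)`
and forcing term `F`, given by Duhamel's formula. -/
def duhamel (d : ℕ) (t : ℝ) (f g : (Fin d → ℤ) → ℂ) (F : ℝ → (Fin d → ℤ) → ℂ)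
    (x : Fin d → ℤ) : ℂ :=
  cosProp d t f x + sinProp d t g x + ∫ s in (0:ℝ)..t, sinProp d (t - s) (F s) x

/-- The `L^q` norm in time of an `ℝ≥0∞`-valued function. -/
def lqNorm (q : ℝ≥0∞) (g : ℝ → ℝ≥0∞) : ℝ≥0∞ :=
  if q = ∞ then essSup g volume else (∫⁻ t, g t ^ q.toReal) ^ (1 / q.toReal)

/-- The mixed space-time norm `‖F‖_{L^q_t ℓ^r_x}`. -/
def mixedNorm (d : ℕ) (q r : ℝ≥0∞) (F : ℝ → (Fin d → ℤ) → ℂ) : ℝ≥0∞ :=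
  lqNorm q fun t => eLpNorm (F t) r Measure.count


lemma continuous_cexp_mul_I {X : Type*} [TopologicalSpace X] {f : X → ℝ} (hf : Continuous f) :
    Continuous fun x => Complex.exp ((f x : ℂ) * Complex.I) := by
  fun_prop

/-- The part of the integral away from the stationary points, by one integration by parts. -/
lemma norm_integral_exp_cos_middle_le {r δ : ℝ} (hr : r ≠ 0) (hδ : 0 < δ) (hδ' : δ ≤ π / 2) :
    ‖∫ η in δ..(π - δ), Complex.exp (((r * cos η : ℝ) : ℂ) * Complex.I)‖
      ≤ 2 * π / (|r| * δ) := by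
  have hpos : ∀ x ∈ Set.uIcc δ (π - δ), 0 < sin x := by
    intro x hx
    rw [Set.uIcc_of_le (by linarith)] at hx
    exact sin_pos_of_pos_of_lt_pi (by linarith [hx.1]) (by linarith [hx.2])
  have hrC : (r : ℂ) ≠ 0 := by exact_mod_cast hr
  set v : ℝ → ℂ := fun η => Complex.exp (((r * cos η : ℝ) : ℂ) * Complex.I) with hv
  set u : ℝ → ℂ := fun η => ((-(r * sin η)⁻¹ : ℝ) : ℂ) * (-Complex.I) with hu
  have hvd : ∀ x, HasDerivAt v (((-(r * sin x) : ℝ) : ℂ) * Complex.I * v x) x := by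
    intro x
    have h1 : HasDerivAt (fun η : ℝ => ((r * cos η : ℝ) : ℂ)) ((r * -sin x : ℝ) : ℂ) x :=
      ((hasDerivAt_cos x).const_mul r).ofReal_comp
    have := (h1.mul_const Complex.I).cexp
    convert this using 1
    simp only [hv]
    push_cast; ring
  have hud : ∀ x ∈ Set.uIcc δ (π - δ),
      HasDerivAt u (((cos x / (r * sin x ^ 2) : ℝ) : ℂ) * (-Complex.I)) x := by
    intro x hx
    have h := (hpos x hx).ne'
    have h1 : HasDerivAt (fun η : ℝ => -(r * sin η)⁻¹) (cos x / (r * sin x ^ 2)) x := by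
      refine (((hasDerivAt_sin x).const_mul r).fun_inv (mul_ne_zero hr h)).fun_neg.congr_deriv ?_
      field_simp
    exact (h1.ofReal_comp).mul_const _
  have hsin : ContinuousOn (fun x => sin x) (Set.uIcc δ (π - δ)) := continuous_sin.continuousOn
  have hu'c : ContinuousOn (fun x => ((cos x / (r * sin x ^ 2) : ℝ) : ℂ) * (-Complex.I))
      (Set.uIcc δ (π - δ)) := by
    refine ContinuousOn.mul ?_ continuousOn_const
    refine Complex.continuous_ofReal.comp_continuousOn ?_
    refine continuous_cos.continuousOn.div (by fun_prop) ?_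
    intro x hx
    exact mul_ne_zero hr (pow_ne_zero 2 (hpos x hx).ne')
  have hvc : Continuous v := continuous_cexp_mul_I (by fun_prop)
  have hparts := intervalIntegral.integral_mul_deriv_eq_deriv_mul (a := δ) (b := π - δ) hud
    (fun x _ => hvd x) hu'c.intervalIntegrable
    (by apply Continuous.intervalIntegrable; fun_prop)
  have hlhs : ∫ x in δ..(π - δ), u x * (((-(r * sin x) : ℝ) : ℂ) * Complex.I * v x)
      = ∫ x in δ..(π - δ), v x := by
    refine intervalIntegral.integral_congr fun x hx => ?_
    have h := (hpos x hx).ne'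
    have hC : ((sin x : ℝ) : ℂ) ≠ 0 := by exact_mod_cast h
    simp only [hu]
    push_cast at hC ⊢
    field_simp
    ring_nf
    simp
  have hvn : ∀ x, ‖v x‖ = 1 := fun x => Complex.norm_exp_ofReal_mul_I _
  have hun : ∀ x, ‖u x‖ = (|r| * |sin x|)⁻¹ := by
    intro x
    simp only [hu, norm_mul, norm_neg, Complex.norm_I, Complex.norm_real, norm_eq_abs,
      abs_inv, abs_mul, mul_one]
  have hsd : 2 / π * δ ≤ sin δ := mul_le_sin hδ.le hδ'
  have hr0 : 0 < |r| := abs_pos.mpr hr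
  have hsdpos : 0 < sin δ := lt_of_lt_of_le (by positivity) hsd
  have hintg : ‖∫ x in δ..(π - δ), ((cos x / (r * sin x ^ 2) : ℝ) : ℂ) * (-Complex.I) * v x‖
      ≤ |r|⁻¹ * (2 * (cos δ / sin δ)) := by
    have hbd : ‖∫ x in δ..(π - δ), ((cos x / (r * sin x ^ 2) : ℝ) : ℂ) * (-Complex.I) * v x‖
        ≤ ∫ x in δ..(π - δ), |r|⁻¹ * (1 / sin x ^ 2) := by
      refine intervalIntegral.norm_integral_le_of_norm_le (by linarith) ?_ ?_
      · refine Filter.Eventually.of_forall fun x hx => ?_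
        have h := hpos x (Set.Ioc_subset_Icc_self.trans Set.Icc_subset_uIcc hx)
        simp only [norm_mul, norm_neg, Complex.norm_I, Complex.norm_real, norm_eq_abs, hvn,
          mul_one, abs_div, abs_mul, abs_pow, sq_abs]
        rw [← one_div, div_mul_div_comm, one_mul]
        gcongr
        exact abs_cos_le_one x
      · refine ContinuousOn.intervalIntegrable ?_
        refine continuousOn_const.mul (continuousOn_const.div (by fun_prop) ?_)
        intro x hx
        exact pow_ne_zero 2 (hpos x hx).ne'
    refine hbd.trans (le_of_eq ?_)
    rw [intervalIntegral.integral_const_mul]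
    congr 1
    have hF : ∀ x ∈ Set.uIcc δ (π - δ), HasDerivAt (fun y => -(cos y / sin y)) (1 / sin x ^ 2) x := by
      intro x hx
      have h := (hpos x hx).ne'
      refine ((hasDerivAt_cos x).fun_div (hasDerivAt_sin x) h).fun_neg.congr_deriv ?_
      field_simp
      nlinarith [sin_sq_add_cos_sq x]
    rw [intervalIntegral.integral_eq_sub_of_hasDerivAt hF]
    · rw [cos_pi_sub, sin_pi_sub]; ring
    · refine ContinuousOn.intervalIntegrable ?_
      refine (continuousOn_const.div (by fun_prop) ?_)
      intro x hx
      exact pow_ne_zero 2 (hpos x hx).ne'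
  have hcos : 0 ≤ cos δ := cos_nonneg_of_neg_pi_div_two_le_of_le (by linarith [pi_pos]) hδ'
  rw [← hlhs, hparts]
  calc ‖u (π - δ) * v (π - δ) - u δ * v δ -
        ∫ x in δ..(π - δ), ((cos x / (r * sin x ^ 2) : ℝ) : ℂ) * (-Complex.I) * v x‖
      ≤ (‖u (π - δ) * v (π - δ)‖ + ‖u δ * v δ‖) + |r|⁻¹ * (2 * (cos δ / sin δ)) :=
        (norm_sub_le _ _).trans (add_le_add (norm_sub_le _ _) hintg)
    _ = |r|⁻¹ * (2 * (1 + cos δ) / sin δ) := by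
        rw [norm_mul (u _), norm_mul (u _), hvn, hvn, hun, hun, sin_pi_sub, abs_of_pos hsdpos]
        field_simp
        ring
    _ ≤ |r|⁻¹ * (2 * (1 + 1) / (2 / π * δ)) := by
        gcongr
        exact cos_le_one δ
    _ = 2 * π / (|r| * δ) := by
        field_simp
        ring

lemma norm_integral_exp_cos_half_le {r : ℝ} (hr : r ≠ 0) :
    ‖∫ η in (0:ℝ)..π, Complex.exp (((r * cos η : ℝ) : ℂ) * Complex.I)‖
      ≤ 10 * |r| ^ (-(1/2) : ℝ) := by
  have hr0 : 0 < |r| := abs_pos.mpr hr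
  have hpi := pi_gt_three
  have hpi' := pi_lt_d2
  set v : ℝ → ℂ := fun η => Complex.exp (((r * cos η : ℝ) : ℂ) * Complex.I) with hv
  have hvc : Continuous v := continuous_cexp_mul_I (by fun_prop)
  have hvn : ∀ x, ‖v x‖ ≤ 1 := fun x => (Complex.norm_exp_ofReal_mul_I _).le
  have htriv : ∀ a b : ℝ, ‖∫ x in a..b, v x‖ ≤ |b - a| := fun a b => by
    simpa using intervalIntegral.norm_integral_le_of_norm_le_const (a := a) (b := b)
      (fun x _ => hvn x)
  set δ : ℝ := |r| ^ (-(1/2) : ℝ) with hδdef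
  have hδ : 0 < δ := rpow_pos_of_pos hr0 _
  by_cases h1 : |r| < 1
  · have : 1 ≤ δ := one_le_rpow_of_pos_of_le_one_of_nonpos hr0 h1.le (by norm_num)
    refine (htriv 0 π).trans ?_
    rw [sub_zero, abs_of_pos pi_pos]
    linarith
  · have hδ1 : δ ≤ 1 := rpow_le_one_of_one_le_of_nonpos (not_lt.mp h1) (by norm_num)
    have hmul : |r| * δ * δ = 1 := by
      rw [mul_assoc, hδdef, ← rpow_add hr0]
      norm_num
      rw [rpow_neg_one, mul_inv_cancel₀ hr0.ne']
    have hmid := norm_integral_exp_cos_middle_le (δ := δ) hr hδ (by linarith)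
    have hval : 2 * π / (|r| * δ) = 2 * π * δ := by
      rw [div_eq_iff (by positivity)]
      linear_combination (-2 * π) * hmul
    rw [hval] at hmid
    have hii : ∀ a b, IntervalIntegrable v volume a b := fun a b => hvc.intervalIntegrable a b
    rw [← intervalIntegral.integral_add_adjacent_intervals (hii 0 δ) (hii δ π),
      ← intervalIntegral.integral_add_adjacent_intervals (hii δ (π - δ)) (hii (π - δ) π)]
    have ha := htriv 0 δ
    have hb := htriv (π - δ) π
    rw [sub_zero, abs_of_pos hδ] at ha
    rw [show π - (π - δ) = δ by ring, abs_of_pos hδ] at hb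
    calc _ ≤ ‖∫ x in (0:ℝ)..δ, v x‖ + (‖∫ x in δ..(π - δ), v x‖ + ‖∫ x in (π - δ)..π, v x‖) :=
          (norm_add_le _ _).trans (add_le_add le_rfl (norm_add_le _ _))
      _ ≤ δ + (2 * π * δ + δ) := by gcongr
      _ ≤ 10 * δ := by nlinarith

/-- Square-root decay of the Bessel function `J₀`. -/
lemma norm_integral_exp_sin_le {r : ℝ} (hr : r ≠ 0) :
    ‖∫ η in (0:ℝ)..(2 * π), Complex.exp (((r * sin η : ℝ) : ℂ) * Complex.I)‖
      ≤ 20 * |r| ^ (-(1/2) : ℝ) := by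
  set v : ℝ → ℂ := fun η => Complex.exp (((r * cos η : ℝ) : ℂ) * Complex.I) with hv
  have hvc : Continuous v := continuous_cexp_mul_I (by fun_prop)
  have hii : ∀ a b, IntervalIntegrable v volume a b := fun a b => hvc.intervalIntegrable a b
  have hper : Function.Periodic v (2 * π) := fun x => by simp only [hv, cos_add_two_pi]
  have h1 : ∫ η in (0:ℝ)..(2 * π), Complex.exp (((r * sin η : ℝ) : ℂ) * Complex.I)
      = ∫ η in (0:ℝ)..(2 * π), v η := by
    have : (fun η : ℝ => Complex.exp (((r * sin η : ℝ) : ℂ) * Complex.I))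
        = fun η => v (η - π / 2) := by
      funext η
      simp only [hv, cos_sub_pi_div_two]
    rw [this, intervalIntegral.integral_comp_sub_right]
    have := hper.intervalIntegral_add_eq (-(π / 2)) 0
    rw [zero_add] at this
    rw [← this]
    congr 1 <;> ring
  have h2 : ∫ η in π..(2 * π), v η
      = ∫ η in (0:ℝ)..π, Complex.exp ((((-r) * cos η : ℝ) : ℂ) * Complex.I) := by
    have : (fun η : ℝ => Complex.exp ((((-r) * cos η : ℝ) : ℂ) * Complex.I))
        = fun η => v (η + π) := by
      funext η
      simp only [hv, cos_add_pi]
      congr 3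
      ring
    rw [this, intervalIntegral.integral_comp_add_right]
    congr 1 <;> ring
  rw [h1, ← intervalIntegral.integral_add_adjacent_intervals (hii 0 π) (hii π (2 * π)), h2]
  have ha := norm_integral_exp_cos_half_le hr
  have hb := norm_integral_exp_cos_half_le (neg_ne_zero.mpr hr)
  rw [abs_neg] at hb
  refine (norm_add_le _ _).trans ?_
  linarith

/-- Matrix entries of the one-dimensional lattice propagator, i.e. the Bessel function
`iⁿ Jₙ(2τ)`. -/
def latticeKernel (τ : ℝ) (n : ℤ) : ℂ :=
  ((2 * π : ℝ) : ℂ)⁻¹ *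
    ∫ ξ in (0:ℝ)..(2 * π), Complex.exp (((n * ξ + 2 * τ * cos ξ : ℝ) : ℂ) * Complex.I)

lemma integral_swap_of_continuous {E : Type*} [NormedAddCommGroup E] [NormedSpace ℝ E]
    {F : ℝ → ℝ → E} (hF : Continuous (Function.uncurry F)) (a b c d : ℝ) :
    ∫ x in a..b, ∫ y in c..d, F x y = ∫ y in c..d, ∫ x in a..b, F x y := by
  refine intervalIntegral_intervalIntegral_swap ?_
  have h : IntegrableOn (Function.uncurry F) (Set.uIcc a b ×ˢ Set.uIcc c d) :=
    hF.continuousOn.integrableOn_compact (isCompact_uIcc.prod isCompact_uIcc)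
  exact h.mono_set (Set.prod_mono Set.uIoc_subset_uIcc Set.uIoc_subset_uIcc)

lemma integral_comp_add_of_periodic {f : ℝ → ℂ} (hf : Function.Periodic f (2 * π)) (c : ℝ) :
    ∫ x in (0:ℝ)..(2 * π), f (x + c) = ∫ x in (0:ℝ)..(2 * π), f x := by
  rw [intervalIntegral.integral_comp_add_right]
  have := hf.intervalIntegral_add_eq c 0
  rw [zero_add] at this
  rw [← this]
  congr 1 <;> ring

lemma continuous_latticeKernel (n : ℤ) : Continuous fun τ => latticeKernel τ n := by
  refine continuous_const.mul ?_
  exact intervalIntegral.continuous_parametric_intervalIntegral_of_continuous'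
    (f := fun τ ξ => Complex.exp (((n * ξ + 2 * τ * cos ξ : ℝ) : ℂ) * Complex.I))
    (continuous_cexp_mul_I (f := fun q : ℝ × ℝ => n * q.2 + 2 * q.1 * cos q.2) (by fun_prop)) _ _

lemma sq_norm_latticeKernel (τ : ℝ) (n : ℤ) :
    ((‖latticeKernel τ n‖ ^ 2 : ℝ) : ℂ) = (((2 * π : ℝ) : ℂ)⁻¹) ^ 2 *
      ∫ w in (0:ℝ)..(2 * π), ∫ η in (0:ℝ)..(2 * π),
        Complex.exp (((n * w - 4 * τ * sin (w / 2) * sin η : ℝ) : ℂ) * Complex.I) := by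
  set θ : ℝ → ℝ := fun ξ => n * ξ + 2 * τ * cos ξ with hθ
  have hθc : Continuous θ := by fun_prop
  set g : ℝ → ℂ := fun ξ => Complex.exp ((θ ξ : ℂ) * Complex.I) with hg
  have hgper : Function.Periodic g (2 * π) := by
    intro ξ
    simp only [hg, hθ, cos_add_two_pi]
    rw [Complex.exp_eq_exp_iff_exists_int]
    exact ⟨n, by push_cast; ring⟩
  have hconj : (starRingEnd ℂ) (∫ ξ in (0:ℝ)..(2 * π), g ξ)
      = ∫ ξ in (0:ℝ)..(2 * π), Complex.exp (((-θ ξ : ℝ) : ℂ) * Complex.I) := by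
    rw [intervalIntegral.integral_of_le (by positivity), intervalIntegral.integral_of_le
      (by positivity), ← integral_conj]
    congr 1
    funext ξ
    simp only [hg, ← Complex.exp_conj, map_mul, Complex.conj_ofReal, Complex.conj_I]
    congr 1
    push_cast; ring
  have hmain : (∫ ξ in (0:ℝ)..(2 * π), g ξ) *
      (∫ ξ in (0:ℝ)..(2 * π), Complex.exp (((-θ ξ : ℝ) : ℂ) * Complex.I))
      = ∫ w in (0:ℝ)..(2 * π), ∫ η in (0:ℝ)..(2 * π),
        Complex.exp (((n * w - 4 * τ * sin (w / 2) * sin η : ℝ) : ℂ) * Complex.I) := by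
    rw [← intervalIntegral.integral_const_mul]
    have h1 : ∀ η : ℝ, (∫ ξ in (0:ℝ)..(2 * π), g ξ) * Complex.exp (((-θ η : ℝ) : ℂ) * Complex.I)
        = ∫ w in (0:ℝ)..(2 * π), Complex.exp (((θ (w + η) - θ η : ℝ) : ℂ) * Complex.I) := by
      intro η
      rw [← integral_comp_add_of_periodic hgper η, ← intervalIntegral.integral_mul_const]
      congr 1
      funext w
      simp only [hg]
      rw [← Complex.exp_add]
      congr 1
      push_cast; ring
    simp_rw [h1]
    rw [integral_swap_of_continuous (F := fun η w =>
      Complex.exp (((θ (w + η) - θ η : ℝ) : ℂ) * Complex.I))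
      (continuous_cexp_mul_I (f := fun q : ℝ × ℝ => θ (q.2 + q.1) - θ q.1) (by fun_prop))]
    congr 1
    funext w
    have hper : Function.Periodic (fun η => Complex.exp (((n * w - 4 * τ * sin (w / 2) * sin η : ℝ)
        : ℂ) * Complex.I)) (2 * π) := fun η => by simp only [sin_add_two_pi]
    rw [← integral_comp_add_of_periodic hper (w / 2)]
    congr 1
    funext η
    congr 3
    simp only [hθ]
    have hc : cos (w + η) - cos η = -2 * sin (w / 2) * sin (η + w / 2) := by
      rw [cos_sub_cos, show (w + η + η) / 2 = η + w / 2 by ring, show (w + η - η) / 2 = w / 2 by ring]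
      ring
    linear_combination 2 * τ * hc
  have : ((‖latticeKernel τ n‖ ^ 2 : ℝ) : ℂ)
      = latticeKernel τ n * (starRingEnd ℂ) (latticeKernel τ n) := by
    rw [Complex.mul_conj, Complex.normSq_eq_norm_sq]
  rw [this, ← hmain, latticeKernel, map_mul, map_inv₀, Complex.conj_ofReal, hconj]
  ring

lemma norm_latticeKernel_le_one (τ : ℝ) (n : ℤ) : ‖latticeKernel τ n‖ ≤ 1 := by
  have h : ‖∫ ξ in (0:ℝ)..(2 * π),
      Complex.exp (((n * ξ + 2 * τ * cos ξ : ℝ) : ℂ) * Complex.I)‖ ≤ 1 * |2 * π - 0| :=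
    intervalIntegral.norm_integral_le_of_norm_le_const
      fun x _ => (Complex.norm_exp_ofReal_mul_I _).le
  have hpos : (0:ℝ) < 2 * π := by positivity
  rw [one_mul, sub_zero, abs_of_pos hpos] at h
  rw [latticeKernel, norm_mul, norm_inv, Complex.norm_real, norm_eq_abs, abs_of_pos hpos]
  rw [inv_mul_le_iff₀ hpos, mul_one]
  exact h

lemma intervalIntegrable_abs_sin_rpow {p : ℝ} (hp0 : 0 ≤ p) (hp : p < 1) (a b : ℝ) :
    IntervalIntegrable (fun x => |sin x| ^ (-p)) volume a b := by
  have hper : Function.Periodic (fun x => |sin x| ^ (-p)) π := fun x => by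
    simp only [sin_add_pi, abs_neg]
  refine hper.intervalIntegrable pi_ne_zero (t := 0) ?_ a b
  rw [zero_add]
  have hhalf : IntervalIntegrable (fun x => |sin x| ^ (-p)) volume 0 (π / 2) := by
    have hdom : IntervalIntegrable (fun x : ℝ => (2 / π) ^ (-p) * x ^ (-p)) volume 0 (π / 2) :=
      (intervalIntegral.intervalIntegrable_rpow' (by linarith)).const_mul _
    refine hdom.mono_fun'
      ((by fun_prop : Measurable fun x => |sin x| ^ (-p)).aestronglyMeasurable) ?_
    rw [Set.uIoc_of_le (by positivity)]
    refine (ae_restrict_iff' measurableSet_Ioc).mpr (Filter.Eventually.of_forall fun x hx => ?_)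
    beta_reduce
    rw [norm_of_nonneg (by positivity), ← mul_rpow (by positivity) hx.1.le]
    refine rpow_le_rpow_of_nonpos (by have := hx.1; positivity) ?_ (by linarith)
    exact (mul_le_sin hx.1.le hx.2).trans (le_abs_self _)
  have hhalf' : IntervalIntegrable (fun x => |sin x| ^ (-p)) volume (π / 2) π := by
    have h := (hhalf.comp_sub_left π).symm
    simp only [sin_pi_sub] at h
    convert h using 1 <;> ring
  exact hhalf.trans hhalf'

lemma ae_sin_ne_zero : ∀ᵐ x : ℝ, sin x ≠ 0 := by
  have : {x : ℝ | sin x = 0} ⊆ Set.range fun n : ℤ => (n : ℝ) * π := fun x hx =>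
    sin_eq_zero_iff.mp hx
  exact measure_mono_null (by simpa [Set.compl_ofPred] using this)
    ((Set.countable_range _).measure_zero volume)

lemma ae_sin_half_ne_zero : ∀ᵐ x : ℝ, sin (x / 2) ≠ 0 := by
  have : {x : ℝ | sin (x / 2) = 0} ⊆ Set.range fun n : ℤ => 2 * ((n : ℝ) * π) := fun x hx => by
    obtain ⟨n, hn⟩ := sin_eq_zero_iff.mp hx
    exact ⟨n, by simp only [hn]; ring⟩
  exact measure_mono_null (by simpa [Set.compl_ofPred] using this)
    ((Set.countable_range _).measure_zero volume)

lemma intervalIntegrable_abs_sin_half_rpow {p : ℝ} (hp0 : 0 ≤ p) (hp : p < 1) :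
    IntervalIntegrable (fun x => |sin (x / 2)| ^ (-p)) volume 0 (2 * π) := by
  have h := (intervalIntegrable_abs_sin_rpow hp0 hp 0 π).comp_mul_left (c := 1 / 2)
  convert h using 1
  · funext x; congr 3; ring
  · simp
  · ring

/-- Pointwise decay of the one-dimensional lattice propagator. -/
lemma exists_sq_norm_latticeKernel_le :
    ∃ C : ℝ, 0 < C ∧ ∀ (τ : ℝ) (n : ℤ), τ ≠ 0 →
      ‖latticeKernel τ n‖ ^ 2 ≤ C * |τ| ^ (-(1/2) : ℝ) := by
  set Q : ℝ := ∫ w in (0:ℝ)..(2 * π), |sin (w / 2)| ^ (-(1/2) : ℝ) with hQ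
  have hQ0 : 0 ≤ Q := intervalIntegral.integral_nonneg (by positivity) fun _ _ => by positivity
  refine ⟨20 * Q + 1, by positivity, fun τ n hτ => ?_⟩
  have hτ0 : 0 < |τ| := abs_pos.mpr hτ
  have h := congrArg norm (sq_norm_latticeKernel τ n)
  rw [Complex.norm_real, norm_of_nonneg (by positivity)] at h
  rw [h, norm_mul, norm_pow, norm_inv, Complex.norm_real, norm_of_nonneg (by positivity)]
  have hbd : ‖∫ w in (0:ℝ)..(2 * π), ∫ η in (0:ℝ)..(2 * π),
        Complex.exp (((n * w - 4 * τ * sin (w / 2) * sin η : ℝ) : ℂ) * Complex.I)‖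
      ≤ ∫ w in (0:ℝ)..(2 * π), 20 * |τ| ^ (-(1/2) : ℝ) * |sin (w / 2)| ^ (-(1/2) : ℝ) := by
    refine intervalIntegral.norm_integral_le_of_norm_le (by positivity) ?_
      ((intervalIntegrable_abs_sin_half_rpow (by norm_num) (by norm_num)).const_mul _)
    filter_upwards [ae_sin_half_ne_zero] with w hw _
    have hfac : ∀ η : ℝ, Complex.exp (((n * w - 4 * τ * sin (w / 2) * sin η : ℝ) : ℂ) * Complex.I)
        = Complex.exp (((n * w : ℝ) : ℂ) * Complex.I) *
          Complex.exp ((((-(4 * τ * sin (w / 2))) * sin η : ℝ) : ℂ) * Complex.I) := by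
      intro η
      rw [← Complex.exp_add]
      congr 1
      push_cast; ring
    simp_rw [hfac]
    rw [intervalIntegral.integral_const_mul, norm_mul, Complex.norm_exp_ofReal_mul_I, one_mul]
    have hne : -(4 * τ * sin (w / 2)) ≠ 0 :=
      neg_ne_zero.mpr (mul_ne_zero (mul_ne_zero (by norm_num) hτ) hw)
    refine (norm_integral_exp_sin_le hne).trans ?_
    rw [mul_assoc 20, ← mul_rpow (abs_nonneg _) (abs_nonneg _), ← abs_mul, abs_neg]
    refine mul_le_mul_of_nonneg_left ?_ (by norm_num)
    refine rpow_le_rpow_of_nonpos (abs_pos.mpr (mul_ne_zero hτ hw)) ?_ (by norm_num)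
    rw [mul_assoc, abs_mul 4, abs_of_pos (by norm_num : (0:ℝ) < 4)]
    linarith [abs_nonneg (τ * sin (w / 2))]
  rw [intervalIntegral.integral_const_mul] at hbd
  have hpi : ((2 * π)⁻¹) ^ 2 ≤ (1:ℝ) := by
    refine pow_le_one₀ (by positivity) (inv_le_one_of_one_le₀ (by linarith [pi_gt_three]))
  calc _ ≤ 1 * (20 * |τ| ^ (-(1/2) : ℝ) * Q) := by gcongr
    _ ≤ _ := by nlinarith [rpow_pos_of_pos hτ0 (-(1/2) : ℝ)]

lemma norm_integral_exp_linear_le {a b c p : ℝ} (hab : a ≤ b) (hc : c ≠ 0) (hp0 : 0 ≤ p)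
    (hp : p ≤ 1) (d : ℝ) :
    ‖∫ t in a..b, Complex.exp (((d - c * t : ℝ) : ℂ) * Complex.I)‖
      ≤ (b - a) ^ (1 - p) * (2 / |c|) ^ p := by
  set X := ‖∫ t in a..b, Complex.exp (((d - c * t : ℝ) : ℂ) * Complex.I)‖ with hX
  have hX0 : 0 ≤ X := norm_nonneg _
  have h1 : X ≤ b - a := by
    have := intervalIntegral.norm_integral_le_of_norm_le_const (a := a) (b := b) (C := 1)
      (f := fun t : ℝ => Complex.exp (((d - c * t : ℝ) : ℂ) * Complex.I))
      fun x _ => (Complex.norm_exp_ofReal_mul_I _).le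
    rwa [one_mul, abs_of_nonneg (by linarith)] at this
  have h2 : X ≤ 2 / |c| := by
    have hcC : -(c : ℂ) * Complex.I ≠ 0 :=
      mul_ne_zero (neg_ne_zero.mpr (by exact_mod_cast hc)) Complex.I_ne_zero
    have hfac : ∀ t : ℝ, Complex.exp (((d - c * t : ℝ) : ℂ) * Complex.I)
        = Complex.exp ((d : ℂ) * Complex.I) * Complex.exp (-(c : ℂ) * Complex.I * t) := by
      intro t
      rw [← Complex.exp_add]
      congr 1
      push_cast; ring
    have hn : ∀ t : ℝ, ‖Complex.exp (-(c : ℂ) * Complex.I * t)‖ = 1 := by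
      intro t
      rw [show -(c : ℂ) * Complex.I * t = ((-(c * t) : ℝ) : ℂ) * Complex.I by push_cast; ring]
      exact Complex.norm_exp_ofReal_mul_I _
    rw [hX]
    simp_rw [hfac]
    rw [intervalIntegral.integral_const_mul, norm_mul, Complex.norm_exp_ofReal_mul_I, one_mul,
      integral_exp_mul_complex hcC, norm_div, norm_mul, Complex.norm_I, mul_one, norm_neg,
      Complex.norm_real, norm_eq_abs]
    gcongr
    refine (norm_sub_le _ _).trans ?_
    rw [hn, hn]
    norm_num
  calc X = X ^ (1 - p) * X ^ p := by
        rcases hX0.eq_or_lt with h | h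
        · rw [← h]
          rcases eq_or_ne p 0 with rfl | hp'
          · simp
          · simp [zero_rpow hp']
        · rw [← rpow_add h]; simp
    _ ≤ _ := by
        refine mul_le_mul (rpow_le_rpow hX0 h1 (by linarith)) (rpow_le_rpow hX0 h2 hp0)
          (by positivity) (rpow_nonneg (by linarith) _)

/-- Local smoothing: time averages of the one-dimensional propagator. -/
lemma exists_integral_sq_norm_latticeKernel_le {p : ℝ} (hp0 : 0 ≤ p) (hp : p < 1) :
    ∃ C : ℝ, 0 < C ∧ ∀ (s : ℝ) (n : ℤ) (a b : ℝ), |s| = 1 → a ≤ b →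
      ∫ t in a..b, ‖latticeKernel (s * t) n‖ ^ 2 ≤ C * (b - a) ^ (1 - p) := by
  set Q : ℝ := ∫ w in (0:ℝ)..(2 * π), |sin (w / 2)| ^ (-p) with hQ
  set R : ℝ := ∫ w in (0:ℝ)..(2 * π), |sin w| ^ (-p) with hR
  have hQ0 : 0 ≤ Q := intervalIntegral.integral_nonneg (by positivity) fun _ _ => by positivity
  have hR0 : 0 ≤ R := intervalIntegral.integral_nonneg (by positivity) fun _ _ => by positivity
  refine ⟨Q * R + 1, by positivity, fun s n a b hs hab => ?_⟩
  set E : ℝ → ℝ → ℝ → ℂ := fun t w η =>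
    Complex.exp (((n * w - 4 * (s * t) * sin (w / 2) * sin η : ℝ) : ℂ) * Complex.I) with hE
  have hE3 : Continuous fun q : ℝ × ℝ × ℝ => E q.1 q.2.1 q.2.2 :=
    continuous_cexp_mul_I
      (f := fun q : ℝ × ℝ × ℝ => n * q.2.1 - 4 * (s * q.1) * sin (q.2.1 / 2) * sin q.2.2)
      (by fun_prop)
  have hE2 : Continuous (Function.uncurry fun t w => ∫ η in (0:ℝ)..(2 * π), E t w η) :=
    intervalIntegral.continuous_parametric_intervalIntegral_of_continuous'
      (f := fun (q : ℝ × ℝ) η => E q.1 q.2 η)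
      (hE3.comp (by fun_prop : Continuous fun q : (ℝ × ℝ) × ℝ => (q.1.1, q.1.2, q.2))) _ _
  have hcast : ((∫ t in a..b, ‖latticeKernel (s * t) n‖ ^ 2 : ℝ) : ℂ)
      = (((2 * π : ℝ) : ℂ)⁻¹) ^ 2 *
        ∫ w in (0:ℝ)..(2 * π), ∫ η in (0:ℝ)..(2 * π), ∫ t in a..b, E t w η := by
    rw [← intervalIntegral.integral_ofReal]
    simp_rw [sq_norm_latticeKernel]
    rw [intervalIntegral.integral_const_mul, integral_swap_of_continuous hE2]
    congr 2
    funext w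
    exact integral_swap_of_continuous (F := fun t η => E t w η)
      (hE3.comp (by fun_prop : Continuous fun q : ℝ × ℝ => (q.1, w, q.2))) _ _ _ _
  have hba : 0 ≤ (b - a) ^ (1 - p) := rpow_nonneg (by linarith) _
  have hinner : ∀ w, sin (w / 2) ≠ 0 → ‖∫ η in (0:ℝ)..(2 * π), ∫ t in a..b, E t w η‖
      ≤ (b - a) ^ (1 - p) * |sin (w / 2)| ^ (-p) * R := by
    intro w hw
    rw [hR, ← intervalIntegral.integral_const_mul]
    refine intervalIntegral.norm_integral_le_of_norm_le (by positivity) ?_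
      ((intervalIntegrable_abs_sin_rpow hp0 hp _ _).const_mul _)
    filter_upwards [ae_sin_ne_zero] with η hη _
    have hs0 : s ≠ 0 := by rintro rfl; simp at hs
    have hne : 4 * s * sin (w / 2) * sin η ≠ 0 :=
      mul_ne_zero (mul_ne_zero (mul_ne_zero (by norm_num) hs0) hw) hη
    have h := norm_integral_exp_linear_le hab hne hp0 hp.le (n * w)
    have heq : ∀ t : ℝ, E t w η
        = Complex.exp (((n * w - 4 * s * sin (w / 2) * sin η * t : ℝ) : ℂ) * Complex.I) := by
      intro t
      simp only [hE]
      congr 3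
      ring
    simp_rw [heq]
    refine h.trans ?_
    rw [mul_assoc ((b - a) ^ (1 - p)), ← mul_rpow (abs_nonneg _) (abs_nonneg _), rpow_neg (by positivity),
      ← inv_rpow (by positivity)]
    refine mul_le_mul_of_nonneg_left (rpow_le_rpow (by positivity) ?_ hp0) hba
    have hw' := abs_pos.mpr hw
    have hη' := abs_pos.mpr hη
    rw [abs_mul, abs_mul, abs_mul, hs, abs_of_pos (by norm_num : (0:ℝ) < 4), div_le_iff₀
      (by positivity)]
    field_simp
    norm_num
  have hbd : ‖∫ w in (0:ℝ)..(2 * π), ∫ η in (0:ℝ)..(2 * π), ∫ t in a..b, E t w η‖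
      ≤ ∫ w in (0:ℝ)..(2 * π), (b - a) ^ (1 - p) * R * |sin (w / 2)| ^ (-p) := by
    refine intervalIntegral.norm_integral_le_of_norm_le (by positivity) ?_
      ((intervalIntegrable_abs_sin_half_rpow hp0 hp).const_mul _)
    filter_upwards [ae_sin_half_ne_zero] with w hw _
    refine (hinner w hw).trans (le_of_eq (by ring))
  rw [intervalIntegral.integral_const_mul] at hbd
  have hpi : ((2 * π)⁻¹) ^ 2 ≤ (1:ℝ) := by
    refine pow_le_one₀ (by positivity) (inv_le_one_of_one_le₀ (by linarith [pi_gt_three]))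
  have h := congrArg norm hcast
  rw [Complex.norm_real, norm_of_nonneg (intervalIntegral.integral_nonneg hab fun _ _ => by
    positivity)] at h
  rw [h, norm_mul, norm_pow, norm_inv, Complex.norm_real, norm_of_nonneg (by positivity)]
  calc _ ≤ 1 * ((b - a) ^ (1 - p) * R * Q) := by gcongr
    _ ≤ _ := by nlinarith

lemma prod_four_le {a b c d : ℝ} :
    a * b * c * d ≤ (a ^ 4 + b ^ 4 + c ^ 4 + d ^ 4) / 4 := by
  nlinarith [sq_nonneg (a * b - c * d), sq_nonneg (a ^ 2 - b ^ 2), sq_nonneg (c ^ 2 - d ^ 2)]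

/-- Time-integrated decay of the four-dimensional lattice propagator over a dyadic interval. -/
lemma exists_integral_prod_latticeKernel_le {κ : ℝ} (hκ : 0 < κ) (hκ1 : κ ≤ 1) :
    ∃ C : ℝ, 0 < C ∧ ∀ (s T : ℝ) (n : Fin 4 → ℤ), |s| = 1 → 0 < T →
      ∫ t in T..(2 * T), ∏ j, ‖latticeKernel (s * t) (n j)‖ ≤ C * T ^ (κ - 1 / 2) := by
  obtain ⟨C₁, hC₁, h₁⟩ := exists_sq_norm_latticeKernel_le
  obtain ⟨C₂, hC₂, h₂⟩ := exists_integral_sq_norm_latticeKernel_le (p := 1 - κ)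
    (by linarith) (by linarith)
  refine ⟨C₁ * C₂, by positivity, fun s T n hs hT => ?_⟩
  have hcont : ∀ m : ℤ, Continuous fun t => ‖latticeKernel (s * t) m‖ := fun m =>
    ((continuous_latticeKernel m).comp (by fun_prop : Continuous fun t : ℝ => s * t)).norm
  have hfour : ∀ m : ℤ, ∫ t in T..(2 * T), ‖latticeKernel (s * t) m‖ ^ 4
      ≤ C₁ * C₂ * T ^ (κ - 1 / 2) := by
    intro m
    calc ∫ t in T..(2 * T), ‖latticeKernel (s * t) m‖ ^ 4
        ≤ ∫ t in T..(2 * T), C₁ * T ^ (-(1/2) : ℝ) * ‖latticeKernel (s * t) m‖ ^ 2 := by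
          refine intervalIntegral.integral_mono_on (by linarith)
            (((hcont m).pow 4).intervalIntegrable _ _)
            ((((hcont m).pow 2).const_mul _).intervalIntegrable _ _) fun t ht => ?_
          have ht0 : 0 < t := hT.trans_le ht.1
          have hs0 : s ≠ 0 := by rintro rfl; simp at hs
          have h := h₁ (s * t) m (mul_ne_zero hs0 ht0.ne')
          rw [abs_mul, hs, one_mul, abs_of_pos ht0] at h
          have h' : t ^ (-(1/2) : ℝ) ≤ T ^ (-(1/2) : ℝ) :=
            rpow_le_rpow_of_nonpos hT ht.1 (by norm_num)
          rw [show ‖latticeKernel (s * t) m‖ ^ 4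
            = ‖latticeKernel (s * t) m‖ ^ 2 * ‖latticeKernel (s * t) m‖ ^ 2 by ring]
          refine mul_le_mul_of_nonneg_right (h.trans ?_) (by positivity)
          gcongr
      _ ≤ C₁ * T ^ (-(1/2) : ℝ) * (C₂ * T ^ κ) := by
          rw [intervalIntegral.integral_const_mul]
          have h := h₂ s m T (2 * T) hs (by linarith)
          rw [show 2 * T - T = T by ring, show 1 - (1 - κ) = κ by ring] at h
          gcongr
      _ = C₁ * C₂ * T ^ (κ - 1 / 2) := by
          rw [show κ - 1 / 2 = κ + -(1/2) by ring, rpow_add hT]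
          ring
  have hii : ∀ m : ℤ, IntervalIntegrable (fun t => ‖latticeKernel (s * t) m‖ ^ 4) volume T (2 * T) :=
    fun m => ((hcont m).pow 4).intervalIntegrable _ _
  calc ∫ t in T..(2 * T), ∏ j, ‖latticeKernel (s * t) (n j)‖
      ≤ ∫ t in T..(2 * T), (1 / 4 : ℝ) * ∑ j, ‖latticeKernel (s * t) (n j)‖ ^ 4 := by
        refine intervalIntegral.integral_mono_on (by linarith)
          ((continuous_finsetProd _ fun j _ => hcont (n j)).intervalIntegrable _ _)
          ((continuous_const.mul (continuous_finsetSum _ fun j _ =>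
            (hcont (n j)).pow 4)).intervalIntegrable _ _) fun t _ => ?_
        rw [Fin.prod_univ_four, Fin.sum_univ_four]
        linarith [prod_four_le (a := ‖latticeKernel (s * t) (n 0)‖)
          (b := ‖latticeKernel (s * t) (n 1)‖) (c := ‖latticeKernel (s * t) (n 2)‖)
          (d := ‖latticeKernel (s * t) (n 3)‖)]
    _ = (1 / 4 : ℝ) * ∑ j, ∫ t in T..(2 * T), ‖latticeKernel (s * t) (n j)‖ ^ 4 := by
        rw [intervalIntegral.integral_const_mul,
          intervalIntegral.integral_finsetSum fun j _ => hii (n j)]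
    _ ≤ C₁ * C₂ * T ^ (κ - 1 / 2) := by
        rw [Fin.sum_univ_four]
        linarith [hfour (n 0), hfour (n 1), hfour (n 2), hfour (n 3)]

/-- The Hilbert space `ℓ²(ℤ^d)`. -/
abbrev LatticeL2 (d : ℕ) := lp (fun _ : Fin d → ℤ => ℂ) 2

namespace LatticeL2

variable {d : ℕ}

/-- The unit vector supported at the lattice point `y`. -/
def delta (y : Fin d → ℤ) : LatticeL2 d := lp.single 2 y (1 : ℂ)

lemma delta_apply (y x : Fin d → ℤ) : (delta y : (Fin d → ℤ) → ℂ) x = if x = y then 1 else 0 := by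
  by_cases h : x = y
  · subst h; simp [delta]
  · simp [delta, h]

lemma norm_delta (y : Fin d → ℤ) : ‖delta y‖ = 1 := by
  rw [delta, lp.norm_single (by norm_num)]; simp

/-- Evaluation at a lattice point, as a continuous linear functional. -/
def eval (x : Fin d → ℤ) : LatticeL2 d →L[ℂ] ℂ :=
  LinearMap.mkContinuous
    { toFun := fun f => f x
      map_add' := fun f g => by simp
      map_smul' := fun c f => by simp } 1 fun f => by
    rw [one_mul]; exact lp.norm_apply_le_norm (by norm_num) f x

lemma eval_apply (x : Fin d → ℤ) (f : LatticeL2 d) : eval x f = f x := rfl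

lemma norm_apply_le (f : LatticeL2 d) (x : Fin d → ℤ) : ‖f x‖ ≤ ‖f‖ :=
  lp.norm_apply_le_norm (by norm_num) f x

lemma hasSum_smul_delta (f : LatticeL2 d) : HasSum (fun y => f y • delta y) f := by
  have h := lp.hasSum_single (p := 2) (by norm_num) f
  convert h using 2 with y
  rw [delta, ← lp.single_smul]
  simp

lemma hasSum_apply (T : LatticeL2 d →L[ℂ] LatticeL2 d) (f : LatticeL2 d) (x : Fin d → ℤ) :
    HasSum (fun y => T (delta y) x * f y) (T f x) := by
  have h := ((eval x).comp T).hasSum (hasSum_smul_delta f)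
  simpa [eval_apply, mul_comm] using h

lemma norm_sq_eq_tsum (f : LatticeL2 d) : ‖f‖ ^ 2 = ∑' x, ‖f x‖ ^ 2 := by
  have := lp.norm_rpow_eq_tsum (p := 2) (by norm_num) f
  simpa using this

lemma summable_norm_sq (f : LatticeL2 d) : Summable fun x => ‖f x‖ ^ 2 := by
  have := (lp.memℓp f).summable (by norm_num)
  simpa using this

lemma sum_norm_sq_le (f : LatticeL2 d) (F : Finset (Fin d → ℤ)) :
    ∑ x ∈ F, ‖f x‖ ^ 2 ≤ ‖f‖ ^ 2 := by
  rw [norm_sq_eq_tsum]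
  exact (summable_norm_sq f).sum_le_tsum _ fun _ _ => by positivity

/-- Translation by `v`. -/
def shift (v : Fin d → ℤ) : LatticeL2 d →L[ℂ] LatticeL2 d :=
  LinearMap.mkContinuous
    { toFun := fun f => ⟨fun x => f (x - v), by
        refine memℓp_gen ?_
        have := (Equiv.subRight v).summable_iff.2 (summable_norm_sq f)
        simpa [Function.comp_def] using this⟩
      map_add' := fun f g => by ext x; rfl
      map_smul' := fun c f => by ext x; rfl } 1 fun f => by
    rw [one_mul, ← sq_le_sq₀ (norm_nonneg _) (norm_nonneg _), norm_sq_eq_tsum, norm_sq_eq_tsum]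
    exact ((Equiv.subRight v).tsum_eq fun x => ‖f x‖ ^ 2).le

lemma shift_apply (v x : Fin d → ℤ) (f : LatticeL2 d) : shift v f x = f (x - v) := rfl

lemma norm_shift_le (v : Fin d → ℤ) : ‖(shift v : LatticeL2 d →L[ℂ] LatticeL2 d)‖ ≤ 1 :=
  LinearMap.mkContinuous_norm_le _ zero_le_one _

lemma shift_delta (v y : Fin d → ℤ) : shift v (delta y) = delta (y + v) := by
  ext x
  rw [shift_apply, delta_apply, delta_apply]
  simp [sub_eq_iff_eq_add]

lemma adjoint_shift (v : Fin d → ℤ) :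
    ContinuousLinearMap.adjoint (shift v : LatticeL2 d →L[ℂ] LatticeL2 d) = shift (-v) := by
  symm
  rw [ContinuousLinearMap.eq_adjoint_iff]
  intro f g
  rw [lp.inner_eq_tsum, lp.inner_eq_tsum, ← (Equiv.subRight v).tsum_eq]
  simp [shift_apply]

/-- The lattice adjacency operator `f ↦ ∑_{|x-y|=1} f y`. -/
def adj (d : ℕ) : LatticeL2 d →L[ℂ] LatticeL2 d :=
  ∑ j : Fin d, (shift (Pi.single j 1) + shift (-Pi.single j 1))

lemma adj_apply (f : LatticeL2 d) (x : Fin d → ℤ) :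
    adj d f x = ∑ j : Fin d, (f (x - Pi.single j 1) + f (x + Pi.single j 1)) := by
  rw [← eval_apply, adj]
  simp [eval_apply, shift_apply]

lemma isSelfAdjoint_adj : IsSelfAdjoint (adj d) := by
  rw [ContinuousLinearMap.isSelfAdjoint_iff', adj, map_sum]
  refine Finset.sum_congr rfl fun j _ => ?_
  rw [map_add, adjoint_shift, adjoint_shift, neg_neg, add_comm]

lemma norm_adj_le : ‖adj d‖ ≤ 2 * d := by
  refine (norm_sum_le_of_le _ fun j _ => (norm_add_le _ _).trans
    (add_le_add (norm_shift_le _) (norm_shift_le _))).trans_eq ?_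
  simp only [Finset.sum_const, Finset.card_univ, Fintype.card_fin, nsmul_eq_mul]; ring

end LatticeL2

/-- The symbol of the adjacency operator. -/
def adjSymbol (d : ℕ) (ξ : Fin d → ℝ) : ℝ := ∑ j, 2 * cos (ξ j)

lemma continuous_adjSymbol (d : ℕ) : Continuous (adjSymbol d) := by
  unfold adjSymbol; fun_prop

lemma abs_adjSymbol_le (d : ℕ) (ξ : Fin d → ℝ) : |adjSymbol d ξ| ≤ 2 * d := by
  refine (Finset.abs_sum_le_sum_abs _ _).trans ?_
  refine (Finset.sum_le_sum (g := fun _ => (2:ℝ)) fun j _ => ?_).trans_eq ?_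
  · rw [abs_mul, abs_two]; linarith [abs_cos_le_one (ξ j)]
  · simp [mul_comm]

/-- The Fourier character `e^{i x·ξ}`. -/
def latticeChar {d : ℕ} (x : Fin d → ℤ) (ξ : Fin d → ℝ) : ℂ :=
  Complex.exp (Complex.I * ((∑ j : Fin d, (x j : ℝ) * ξ j : ℝ) : ℂ))

lemma continuous_latticeChar {d : ℕ} (x : Fin d → ℤ) : Continuous (latticeChar x) := by
  unfold latticeChar; fun_prop

lemma norm_latticeChar {d : ℕ} (x : Fin d → ℤ) (ξ : Fin d → ℝ) : ‖latticeChar x ξ‖ = 1 := by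
  rw [latticeChar, mul_comm, Complex.norm_exp_ofReal_mul_I]

lemma latticeChar_add {d : ℕ} (x y : Fin d → ℤ) (ξ : Fin d → ℝ) :
    latticeChar (x + y) ξ = latticeChar x ξ * latticeChar y ξ := by
  rw [latticeChar, latticeChar, latticeChar, ← Complex.exp_add]
  congr 1
  simp [add_mul, Finset.sum_add_distrib, mul_add]

lemma latticeChar_single_add_neg {d : ℕ} (j : Fin d) (ξ : Fin d → ℝ) :
    latticeChar (-Pi.single j 1) ξ + latticeChar (Pi.single j 1) ξ = 2 * cos (ξ j) := by
  have h : ∑ k : Fin d, (((Pi.single j 1 : Fin d → ℤ) k : ℤ) : ℝ) * ξ k = ξ j := by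
    rw [Finset.sum_eq_single j]
    · simp
    · intro k _ hk; simp [hk]
    · simp
  have h' : ∑ k : Fin d, (((-Pi.single j 1 : Fin d → ℤ) k : ℤ) : ℝ) * ξ k = -ξ j := by
    rw [← h]; simp
  rw [latticeChar, latticeChar, h, h', Complex.ofReal_cos, Complex.two_cos, add_comm]
  congr 2 <;> push_cast <;> ring

/-- The convolution kernel on `ℤ^d` of the Fourier multiplier with symbol `f`. -/
def symbolKernel {d : ℕ} (f : (Fin d → ℝ) → ℂ) (x : Fin d → ℤ) : ℂ :=
  ((((2 * π) ^ d)⁻¹ : ℝ) : ℂ) * ∫ ξ in cube d, latticeChar x ξ * f ξ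

lemma multKernel_eq_symbolKernel (d : ℕ) (m : (Fin d → ℝ) → ℝ) (x : Fin d → ℤ) :
    multKernel d m x = symbolKernel (fun ξ => (m ξ : ℂ)) x := rfl

lemma integrableOn_cube {d : ℕ} {f : (Fin d → ℝ) → ℂ} (hf : Continuous f) :
    IntegrableOn f (cube d) :=
  hf.continuousOn.integrableOn_compact isCompact_Icc

section symbolKernel

variable {d : ℕ} {f g : (Fin d → ℝ) → ℂ}

lemma symbolKernel_add (hf : Continuous f) (hg : Continuous g) (x : Fin d → ℤ) :
    symbolKernel (fun ξ => f ξ + g ξ) x = symbolKernel f x + symbolKernel g x := by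
  have hintg : ∀ {h : (Fin d → ℝ) → ℂ}, Continuous h →
      IntegrableOn (fun ξ => latticeChar x ξ * h ξ) (cube d) :=
    fun hh => integrableOn_cube ((continuous_latticeChar x).mul hh)
  simp only [symbolKernel, mul_add]
  rw [integral_add (hintg hf) (hintg hg), mul_add]

lemma symbolKernel_const_mul (c : ℂ) (x : Fin d → ℤ) :
    symbolKernel (fun ξ => c * f ξ) x = c * symbolKernel f x := by
  simp only [symbolKernel, mul_left_comm _ c, integral_const_mul]

lemma symbolKernel_adjSymbol_mul (hf : Continuous f) (x : Fin d → ℤ) :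
    symbolKernel (fun ξ => adjSymbol d ξ * f ξ) x
      = ∑ j : Fin d, (symbolKernel f (x - Pi.single j 1) + symbolKernel f (x + Pi.single j 1)) := by
  have hintg : ∀ y : Fin d → ℤ, IntegrableOn (fun ξ => latticeChar y ξ * f ξ) (cube d) :=
    fun y => integrableOn_cube ((continuous_latticeChar y).mul hf)
  have hintg₂ : ∀ j : Fin d, IntegrableOn (fun ξ => latticeChar (x - Pi.single j 1) ξ * f ξ
      + latticeChar (x + Pi.single j 1) ξ * f ξ) (cube d) :=
    fun j => (hintg _).add (hintg _)
  simp only [symbolKernel, ← mul_add]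
  rw [← Finset.mul_sum]
  congr 1
  simp_rw [← integral_add (hintg _) (hintg _)]
  rw [← integral_finsetSum _ fun j _ => hintg₂ j]
  congr 1
  ext ξ
  rw [adjSymbol, Complex.ofReal_sum, Finset.sum_mul, Finset.mul_sum]
  refine Finset.sum_congr rfl fun j _ => ?_
  rw [sub_eq_add_neg, latticeChar_add, latticeChar_add, ← add_mul, ← mul_add,
    latticeChar_single_add_neg]
  push_cast; ring

lemma tendsto_symbolKernel {F : ℕ → (Fin d → ℝ) → ℂ} (hF : ∀ n, Continuous (F n)) (c : ℝ)
    (hc : ∀ n ξ, ‖F n ξ‖ ≤ c) (hlim : ∀ ξ, Filter.Tendsto (F · ξ) Filter.atTop (nhds (f ξ)))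
    (x : Fin d → ℤ) :
    Filter.Tendsto (fun n => symbolKernel (F n) x) Filter.atTop (nhds (symbolKernel f x)) := by
  refine Filter.Tendsto.const_mul _ ?_
  refine tendsto_integral_of_dominated_convergence (fun _ => c)
    (fun n => ((continuous_latticeChar x).mul (hF n)).aestronglyMeasurable)
    (integrableOn_const (isCompact_Icc.measure_lt_top.ne)) ?_ ?_
  · intro n
    refine Filter.Eventually.of_forall fun ξ => ?_
    rw [norm_mul, norm_latticeChar, one_mul]; exact hc n ξ
  · exact Filter.Eventually.of_forall fun ξ => (hlim ξ).const_mul _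

lemma symbolKernel_exp_adjSymbol (τ : ℝ) (x : Fin d → ℤ) :
    symbolKernel (fun ξ => Complex.exp (((τ * adjSymbol d ξ : ℝ) : ℂ) * Complex.I)) x
      = ∏ j, latticeKernel τ (x j) := by
  have hcube : (volume.restrict (cube d) : Measure (Fin d → ℝ))
      = Measure.pi fun _ => volume.restrict (Set.Icc (0:ℝ) (2 * π)) := by
    rw [cube, ← Set.pi_univ_Icc, volume_pi, Measure.restrict_pi_pi]
    rfl
  simp only [symbolKernel, latticeKernel]
  rw [hcube, Finset.prod_mul_distrib]
  congr 1
  · simp [mul_comm, mul_pow, inv_pow]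
  · simp_rw [intervalIntegral.integral_of_le two_pi_pos.le, ← integral_Icc_eq_integral_Ioc]
    rw [← integral_fintype_prod_eq_prod (μ := fun _ => volume.restrict (Set.Icc (0:ℝ) (2 * π)))]
    congr 1
    ext ξ
    rw [latticeChar, ← Complex.exp_add, ← Complex.exp_sum]
    congr 1
    rw [← Finset.sum_mul, mul_comm Complex.I, ← add_mul, ← Complex.ofReal_add, adjSymbol,
      Finset.mul_sum, ← Finset.sum_add_distrib, Complex.ofReal_sum]
    congr 1
    refine Finset.sum_congr rfl fun j _ => ?_
    push_cast; ring

end symbolKernel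

/-- `T` is the convolution operator on `ℓ²(ℤ^d)` given by the Fourier multiplier `f`. -/
def HasSymbol {d : ℕ} (T : LatticeL2 d →L[ℂ] LatticeL2 d) (f : (Fin d → ℝ) → ℂ) : Prop :=
  Continuous f ∧ ∀ x y, T (LatticeL2.delta y) x = symbolKernel f (x - y)

namespace HasSymbol

open LatticeL2 Filter Topology

variable {d : ℕ} {S T : LatticeL2 d →L[ℂ] LatticeL2 d} {f g : (Fin d → ℝ) → ℂ}

lemma one : HasSymbol (1 : LatticeL2 d →L[ℂ] LatticeL2 d) fun _ => 1 := by
  refine ⟨continuous_const, fun x y => ?_⟩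
  have h := symbolKernel_exp_adjSymbol (d := d) 0 (x - y)
  simp only [zero_mul, Complex.ofReal_zero, Complex.exp_zero] at h
  rw [h, one_apply_eq_self, delta_apply]
  have h₀ : ∀ n : ℤ, latticeKernel 0 n = if n = 0 then 1 else 0 := by
    intro n
    rw [latticeKernel]
    split_ifs with hn
    · subst hn
      have hpi : (π : ℂ) ≠ 0 := by exact_mod_cast pi_ne_zero
      simp
      field_simp
    · have hc : (n : ℂ) * Complex.I ≠ 0 := by simp [hn]
      have := integral_exp_mul_complex (a := 0) (b := 2 * π) hc
      have h₁ : ∀ ξ : ℝ, Complex.exp (((n * ξ + 2 * 0 * cos ξ : ℝ) : ℂ) * Complex.I)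
          = Complex.exp ((n : ℂ) * Complex.I * ξ) := by
        intro ξ; congr 1; push_cast; ring
      simp_rw [h₁, this]
      have h₂ : Complex.exp ((n : ℂ) * Complex.I * ((2 * π : ℝ) : ℂ)) = 1 := by
        rw [← Complex.exp_int_mul_two_pi_mul_I n]; congr 1; push_cast; ring
      rw [h₂]; simp
  simp_rw [h₀]
  split_ifs with hxy
  · subst hxy; simp
  · obtain ⟨j, hj⟩ := Function.ne_iff.1 (sub_ne_zero.2 hxy)
    exact (Finset.prod_eq_zero (Finset.mem_univ j) (if_neg hj)).symm

lemma add (hS : HasSymbol S f) (hT : HasSymbol T g) :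
    HasSymbol (S + T) fun ξ => f ξ + g ξ :=
  ⟨hS.1.add hT.1, fun x y => by
    rw [symbolKernel_add hS.1 hT.1, ← hS.2, ← hT.2]; rfl⟩

lemma smul (c : ℂ) (hT : HasSymbol T f) : HasSymbol (c • T) fun ξ => c * f ξ :=
  ⟨continuous_const.mul hT.1, fun x y => by
    rw [symbolKernel_const_mul, ← hT.2]; rfl⟩

lemma adj_mul (hT : HasSymbol T f) : HasSymbol (adj d * T) fun ξ => adjSymbol d ξ * f ξ := by
  refine ⟨(Complex.continuous_ofReal.comp (continuous_adjSymbol d)).mul hT.1, fun x y => ?_⟩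
  rw [symbolKernel_adjSymbol_mul hT.1, mul_apply_eq_comp, adj_apply]
  refine Finset.sum_congr rfl fun j _ => ?_
  rw [hT.2, hT.2]
  congr 2 <;> abel

lemma aeval_adj (p : Polynomial ℂ) :
    HasSymbol (Polynomial.aeval (adj d) p) fun ξ => p.eval (adjSymbol d ξ : ℂ) := by
  induction p using Polynomial.induction_on with
  | C a =>
    have := one (d := d) |>.smul a
    simpa [Algebra.algebraMap_eq_smul_one] using this
  | add p q hp hq => simpa using hp.add hq
  | monomial n a h =>
    have := h.adj_mul
    rw [show (Polynomial.C a * Polynomial.X ^ (n + 1) : Polynomial ℂ)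
      = Polynomial.X * (Polynomial.C a * Polynomial.X ^ n) by ring, map_mul, Polynomial.aeval_X]
    simpa only [Polynomial.eval_mul, Polynomial.eval_X] using this

lemma of_tendsto {T' : ℕ → LatticeL2 d →L[ℂ] LatticeL2 d} {F : ℕ → (Fin d → ℝ) → ℂ}
    (h : ∀ n, HasSymbol (T' n) (F n)) (c : ℝ) (hc : ∀ n ξ, ‖F n ξ‖ ≤ c)
    (hT : Tendsto T' atTop (𝓝 T)) (hF : ∀ ξ, Tendsto (F · ξ) atTop (𝓝 (f ξ)))
    (hf : Continuous f) : HasSymbol T f := by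
  refine ⟨hf, fun x y => ?_⟩
  have h₁ : Tendsto (fun n => T' n (delta y) x) atTop (𝓝 (T (delta y) x)) :=
    ((eval x).continuous.tendsto _).comp
      (((ContinuousLinearMap.apply ℂ _ (delta y)).continuous.tendsto T).comp hT)
  have h₂ := tendsto_symbolKernel (fun n => (h n).1) c hc hF (x - y)
  simp_rw [← (h _).2] at h₂
  exact tendsto_nhds_unique h₁ h₂

lemma exp_smul_adj (z : ℂ) :
    HasSymbol (NormedSpace.exp (z • adj d)) fun ξ => Complex.exp (z * adjSymbol d ξ) := by
  let p : ℕ → Polynomial ℂ := fun n =>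
    ∑ k ∈ Finset.range n, Polynomial.monomial k ((k.factorial : ℂ)⁻¹ * z ^ k)
  have hpe : ∀ n (w : ℂ), (p n).eval w
      = ∑ k ∈ Finset.range n, (k.factorial : ℂ)⁻¹ • (z * w) ^ k := by
    intro n w
    simp only [p, Polynomial.eval_finsetSum, Polynomial.eval_monomial, smul_eq_mul]
    exact Finset.sum_congr rfl fun k _ => by ring
  have hpa : ∀ n, Polynomial.aeval (adj d) (p n)
      = ∑ k ∈ Finset.range n, (k.factorial : ℂ)⁻¹ • (z • adj d) ^ k := by
    intro n
    simp only [p, map_sum, Polynomial.aeval_monomial]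
    refine Finset.sum_congr rfl fun k _ => ?_
    rw [smul_pow, smul_smul, Algebra.smul_def]
  refine of_tendsto (fun n => aeval_adj (p n)) (Real.exp (‖z‖ * (2 * d))) ?_ ?_ ?_
    (Complex.continuous_exp.comp
      (continuous_const.mul (Complex.continuous_ofReal.comp (continuous_adjSymbol d))))
  · intro n ξ
    rw [hpe]
    refine (norm_sum_le _ _).trans (le_trans ?_ (Real.sum_le_exp_of_nonneg (by positivity) n))
    refine Finset.sum_le_sum fun k _ => ?_
    rw [norm_smul, norm_inv, norm_pow, norm_mul, Complex.norm_natCast, Complex.norm_real,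
      Real.norm_eq_abs, inv_mul_eq_div]
    gcongr
    exact abs_adjSymbol_le d ξ
  · simp_rw [hpa]
    exact (NormedSpace.exp_series_hasSum_exp' (𝕂 := ℂ) (z • adj d)).tendsto_sum_nat
  · intro ξ
    simp_rw [hpe, Complex.exp_eq_exp_ℂ]
    exact (NormedSpace.exp_series_hasSum_exp' (𝕂 := ℂ) _).tendsto_sum_nat

end HasSymbol

lemma norm_exp_smul_I_adj_le {d : ℕ} (τ : ℝ) :
    ‖NormedSpace.exp (((τ : ℂ) * Complex.I) • LatticeL2.adj d)‖ ≤ 1 := by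
  have hsa : IsSelfAdjoint ((τ : ℂ) • LatticeL2.adj d) :=
    by rw [isSelfAdjoint_iff, star_smul, LatticeL2.isSelfAdjoint_adj.star_eq, Complex.star_def,
      Complex.conj_ofReal]
  have h := CStarRing.norm_coe_unitary_mul (selfAdjoint.expUnitary ⟨_, hsa⟩)
    (1 : LatticeL2 d →L[ℂ] LatticeL2 d)
  rw [mul_one, selfAdjoint.expUnitary_coe, smul_smul, mul_comm Complex.I] at h
  rw [h]
  exact ContinuousLinearMap.norm_id_le

lemma norm_exp_smul_I_adj_delta_apply {d : ℕ} (τ : ℝ) (x y : Fin d → ℤ) :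
    ‖NormedSpace.exp (((τ : ℂ) * Complex.I) • LatticeL2.adj d) (LatticeL2.delta y) x‖
      = ∏ j, ‖latticeKernel τ (x j - y j)‖ := by
  have h := (HasSymbol.exp_smul_adj (d := d) (τ * Complex.I)).2 x y
  rw [h, ← norm_prod]
  congr 1
  rw [show (∏ j, latticeKernel τ (x j - y j)) = ∏ j, latticeKernel τ ((x - y) j) from rfl,
    ← symbolKernel_exp_adjSymbol]
  congr 1
  ext ξ
  congr 1
  push_cast; ring

/-- Column sums of the matrix of `T` are at most `c`. -/
def ColumnBound {d : ℕ} (T : LatticeL2 d →L[ℂ] LatticeL2 d) (c : ℝ) : Prop :=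
  ∀ z, ∀ F : Finset (Fin d → ℤ), ∑ y ∈ F, ‖T (LatticeL2.delta z) y‖ ≤ c

namespace ColumnBound

open LatticeL2 Filter Topology

variable {d : ℕ} {S T : LatticeL2 d →L[ℂ] LatticeL2 d} {a b : ℝ}

lemma nonneg (h : ColumnBound T a) : 0 ≤ a := by simpa using h 0 ∅

lemma mono (h : ColumnBound T a) (hab : a ≤ b) : ColumnBound T b := fun z F => (h z F).trans hab

lemma add (hS : ColumnBound S a) (hT : ColumnBound T b) : ColumnBound (S + T) (a + b) :=
  fun z F => (Finset.sum_le_sum fun y _ => norm_add_le (S (delta z) y) (T (delta z) y)).trans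
    (by rw [Finset.sum_add_distrib]; exact add_le_add (hS z F) (hT z F))

lemma smul (c : ℂ) (hT : ColumnBound T a) : ColumnBound (c • T) (‖c‖ * a) := fun z F => by
  have : ∀ y, ‖(c • T) (delta z) y‖ = ‖c‖ * ‖T (delta z) y‖ := fun y => norm_mul _ _
  simp_rw [this, ← Finset.mul_sum]
  exact mul_le_mul_of_nonneg_left (hT z F) (norm_nonneg _)

lemma sum_delta_le (z : Fin d → ℤ) (F : Finset (Fin d → ℤ)) :
    ∑ y ∈ F, ‖(delta z : LatticeL2 d) y‖ ≤ 1 := by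
  simp_rw [delta_apply, apply_ite norm, norm_one, norm_zero]
  rw [Finset.sum_ite_eq' F z]
  split_ifs <;> norm_num

lemma one : ColumnBound (1 : LatticeL2 d →L[ℂ] LatticeL2 d) 1 := sum_delta_le

lemma shift (v : Fin d → ℤ) : ColumnBound (shift v : LatticeL2 d →L[ℂ] LatticeL2 d) 1 :=
  fun z F => by rw [shift_delta]; exact sum_delta_le _ F

lemma zero : ColumnBound (0 : LatticeL2 d →L[ℂ] LatticeL2 d) 0 := fun z F => by
  simp

lemma sum {ι : Type*} (s : Finset ι) {T : ι → LatticeL2 d →L[ℂ] LatticeL2 d} {a : ι → ℝ}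
    (h : ∀ i ∈ s, ColumnBound (T i) (a i)) : ColumnBound (∑ i ∈ s, T i) (∑ i ∈ s, a i) := by
  classical
  induction s using Finset.induction_on with
  | empty => simpa using zero
  | insert i s hi ih =>
    rw [Finset.sum_insert hi, Finset.sum_insert hi]
    exact (h i (by simp)).add (ih fun k hk => h k (by simp [hk]))

lemma adj : ColumnBound (adj d) (2 * d) := by
  refine (sum Finset.univ fun j _ =>
    (shift (Pi.single j 1)).add (shift (-Pi.single j 1))).mono ?_
  simp only [Finset.sum_const, Finset.card_univ, Fintype.card_fin, nsmul_eq_mul]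
  exact le_of_eq (by ring)

lemma sum_norm_apply_le (hT : ColumnBound T a) {f : LatticeL2 d}
    (hf : ∀ F : Finset (Fin d → ℤ), ∑ y ∈ F, ‖f y‖ ≤ b) (F : Finset (Fin d → ℤ)) :
    ∑ y ∈ F, ‖T f y‖ ≤ a * b := by
  have hsum : Summable fun w => ‖f w‖ := summable_of_sum_le (fun _ => norm_nonneg _) hf
  have hTle : ∀ w y, ‖T (delta w) y‖ ≤ a := fun w y => by simpa using hT w {y}
  have hs : ∀ y, Summable fun w => ‖T (delta w) y‖ * ‖f w‖ := fun y =>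
    Summable.of_nonneg_of_le (fun _ => by positivity)
      (fun w => mul_le_mul_of_nonneg_right (hTle w y) (norm_nonneg _)) (hsum.mul_left a)
  have h₁ : ∀ y, ‖T f y‖ ≤ ∑' w, ‖T (delta w) y‖ * ‖f w‖ := fun y => by
    rw [← (hasSum_apply T f y).tsum_eq]
    refine tsum_of_norm_bounded (hs y).hasSum fun w => (norm_mul _ _).le
  calc ∑ y ∈ F, ‖T f y‖ ≤ ∑ y ∈ F, ∑' w, ‖T (delta w) y‖ * ‖f w‖ :=
        Finset.sum_le_sum fun y _ => h₁ y
    _ = ∑' w, ∑ y ∈ F, ‖T (delta w) y‖ * ‖f w‖ := (Summable.tsum_finsetSum fun y _ => hs y).symm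
    _ ≤ ∑' w, a * ‖f w‖ := by
        refine Summable.tsum_le_tsum (fun w => ?_) (summable_sum fun y _ => hs y) (hsum.mul_left a)
        rw [← Finset.sum_mul]
        exact mul_le_mul_of_nonneg_right (hT w F) (norm_nonneg _)
    _ ≤ a * b := by
        rw [tsum_mul_left]
        exact mul_le_mul_of_nonneg_left (Real.tsum_le_of_sum_le (fun _ => norm_nonneg _) hf)
          hT.nonneg

lemma mul (hS : ColumnBound S a) (hT : ColumnBound T b) : ColumnBound (S * T) (a * b) :=
  fun z F => hS.sum_norm_apply_le (hT z) F

lemma of_tendsto {T' : ℕ → LatticeL2 d →L[ℂ] LatticeL2 d} (h : ∀ n, ColumnBound (T' n) a)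
    (hT : Tendsto T' atTop (𝓝 T)) : ColumnBound T a := by
  intro z F
  have h₁ : ∀ x, Tendsto (fun n => T' n (delta z) x) atTop (𝓝 (T (delta z) x)) := fun x =>
    ((eval x).continuous.tendsto _).comp
      (((ContinuousLinearMap.apply ℂ _ (delta z)).continuous.tendsto T).comp hT)
  exact le_of_tendsto' (tendsto_finsetSum _ fun x _ => (h₁ x).norm) fun n => h n z F

end ColumnBound

lemma LatticeL2.norm_apply_le_of_kernel_le {d : ℕ} {T : LatticeL2 d →L[ℂ] LatticeL2 d}
    {f : LatticeL2 d} {x : Fin d → ℤ} {M c : ℝ} (hM : ∀ y, ‖T (delta y) x‖ ≤ M)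
    (hf : ∀ F : Finset (Fin d → ℤ), ∑ y ∈ F, ‖f y‖ ≤ c) : ‖T f x‖ ≤ M * c := by
  have hM0 : 0 ≤ M := (norm_nonneg _).trans (hM 0)
  have hsum : Summable fun w => ‖f w‖ := summable_of_sum_le (fun _ => norm_nonneg _) hf
  rw [← (hasSum_apply T f x).tsum_eq]
  refine (tsum_of_norm_bounded (hsum.mul_left M).hasSum fun w => ?_).trans ?_
  · rw [norm_mul]; exact mul_le_mul_of_nonneg_right (hM w) (norm_nonneg _)
  · rw [tsum_mul_left]
    exact mul_le_mul_of_nonneg_left (Real.tsum_le_of_sum_le (fun _ => norm_nonneg _) hf) hM0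

/-- Iterates of `w ↦ (s/9 + w²)/2`, which converge to `1 - √(1 - s/9)`, as polynomials in `s`. -/
def sqrtPoly : ℕ → Polynomial ℂ
  | 0 => 0
  | n + 1 => Polynomial.C (1 / 2) * (Polynomial.C (1 / 9) * Polynomial.X + sqrtPoly n ^ 2)

section sqrtPoly

open LatticeL2 Filter Topology

/-- The approximations of `1 - √(1-Δ)/3` in dimension four. -/
def sqrtIter (n : ℕ) : LatticeL2 4 →L[ℂ] LatticeL2 4 :=
  Polynomial.aeval (adj 4) (sqrtPoly n)

lemma sqrtIter_succ (n : ℕ) :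
    sqrtIter (n + 1) = (1 / 2 : ℂ) • ((1 / 9 : ℂ) • adj 4 + sqrtIter n * sqrtIter n) := by
  simp only [sqrtIter, sqrtPoly, map_mul, map_add, Polynomial.aeval_C, Polynomial.aeval_X,
    ← Algebra.smul_def, sq]

lemma norm_sqrtIter_le (n : ℕ) : ‖sqrtIter n‖ ≤ 2 / 3 := by
  induction n with
  | zero => simp [sqrtIter, sqrtPoly]; norm_num
  | succ n ih =>
    have hA : ‖adj 4‖ ≤ 8 := norm_adj_le.trans (by norm_num)
    have h₁ : ‖(1 / 9 : ℂ) • adj 4‖ ≤ 8 / 9 := by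
      rw [norm_smul]; norm_num; linarith
    have h₂ : ‖sqrtIter n * sqrtIter n‖ ≤ 4 / 9 :=
      (norm_mul_le _ _).trans (by nlinarith [norm_nonneg (sqrtIter n)])
    rw [sqrtIter_succ, norm_smul]
    have h₃ := (norm_add_le ((1 / 9 : ℂ) • adj 4) (sqrtIter n * sqrtIter n)).trans
      (add_le_add h₁ h₂)
    norm_num at h₃ ⊢
    linarith

lemma dist_sqrtIter_le (n : ℕ) :
    dist (sqrtIter n) (sqrtIter (n + 1)) ≤ 1 * (2 / 3 : ℝ) ^ n := by
  induction n with
  | zero =>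
    rw [show sqrtIter 0 = 0 by simp [sqrtIter, sqrtPoly], dist_zero_left]
    exact (norm_sqrtIter_le 1).trans (by norm_num)
  | succ n ih =>
    rw [dist_eq_norm] at ih ⊢
    have h : sqrtIter (n + 1) - sqrtIter (n + 1 + 1)
        = (1 / 2 : ℂ) • (sqrtIter n * (sqrtIter n - sqrtIter (n + 1))
          + (sqrtIter n - sqrtIter (n + 1)) * sqrtIter (n + 1)) := by
      rw [sqrtIter_succ (n + 1)]
      nth_rewrite 1 [sqrtIter_succ n]
      rw [← smul_sub]
      congr 1
      noncomm_ring
    have h₁ := (norm_mul_le (sqrtIter n) (sqrtIter n - sqrtIter (n + 1))).trans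
      (mul_le_mul (norm_sqrtIter_le n) ih (norm_nonneg _) (by norm_num))
    have h₂ := (norm_mul_le (sqrtIter n - sqrtIter (n + 1)) (sqrtIter (n + 1))).trans
      (mul_le_mul ih (norm_sqrtIter_le (n + 1)) (norm_nonneg _) (by positivity))
    rw [h, norm_smul, pow_succ]
    have h₃ := norm_add_le (sqrtIter n * (sqrtIter n - sqrtIter (n + 1)))
      ((sqrtIter n - sqrtIter (n + 1)) * sqrtIter (n + 1))
    norm_num
    linarith

lemma columnBound_sqrtIter (n : ℕ) : ColumnBound (sqrtIter n) (2 / 3) := by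
  induction n with
  | zero =>
    rw [show sqrtIter 0 = 0 by simp [sqrtIter, sqrtPoly]]
    exact ColumnBound.zero.mono (by norm_num)
  | succ n ih =>
    rw [sqrtIter_succ]
    refine (((ColumnBound.adj.smul _).add (ih.mul ih)).smul _).mono ?_
    norm_num

lemma norm_sqrtPoly_eval_sub_le {s b : ℝ} (hb : 2 * b = s / 9 + b ^ 2) (hb₁ : |b| ≤ 2 / 3)
    (hs : |s| ≤ 8) (n : ℕ) :
    ‖(sqrtPoly n).eval (s : ℂ)‖ ≤ 2 / 3 ∧ ‖(sqrtPoly n).eval (s : ℂ) - b‖ ≤ (2 / 3 : ℝ) ^ n := by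
  have hbn : ‖(b : ℂ)‖ ≤ 2 / 3 := by rwa [Complex.norm_real]
  have hbc : (2 : ℂ) * b = s / 9 + b ^ 2 := by exact_mod_cast hb
  induction n with
  | zero =>
    simp only [sqrtPoly, Polynomial.eval_zero, norm_zero, zero_sub, norm_neg, pow_zero]
    exact ⟨by norm_num, by linarith⟩
  | succ n ih =>
    set w := (sqrtPoly n).eval (s : ℂ)
    have hw : (sqrtPoly (n + 1)).eval (s : ℂ) = 1 / 2 * (1 / 9 * s + w ^ 2) := by
      simp [sqrtPoly, w]
    have hsn : ‖(1 / 9 * s : ℂ)‖ ≤ 8 / 9 := by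
      rw [norm_mul, Complex.norm_real, Real.norm_eq_abs]; norm_num; linarith
    rw [hw]
    constructor
    · rw [norm_mul]
      have := norm_add_le (1 / 9 * s : ℂ) (w ^ 2)
      rw [norm_pow] at this
      norm_num at this ⊢
      norm_num at hsn
      nlinarith [norm_nonneg w, ih.1]
    · rw [show 1 / 2 * (1 / 9 * (s : ℂ) + w ^ 2) - b = 1 / 2 * ((w + b) * (w - b)) by
        linear_combination (-1 / 2 : ℂ) * hbc, norm_mul, norm_mul, pow_succ]
      have h₁ : ‖w + b‖ ≤ 4 / 3 := (norm_add_le _ _).trans (by linarith [ih.1])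
      have h₂ := mul_le_mul h₁ ih.2 (norm_nonneg _) (by norm_num)
      norm_num
      linarith

lemma omegaKG_four (ξ : Fin 4 → ℝ) : omegaKG 4 ξ = √(9 - adjSymbol 4 ξ) := by
  rw [omegaKG, adjSymbol]
  congr 1
  simp_rw [mul_sub, Finset.sum_sub_distrib]
  norm_num
  ring

/-- The operator `√(1-Δ)` on `ℓ²(ℤ⁴)` as a function of the adjacency operator. -/
theorem exists_hasSymbol_omegaKG :
    ∃ H : LatticeL2 4 →L[ℂ] LatticeL2 4, HasSymbol H (fun ξ => (omegaKG 4 ξ : ℂ)) ∧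
      H * H = (9 : ℂ) • 1 - adj 4 ∧ ‖H‖ ≤ 5 ∧ ColumnBound H 5 := by
  obtain ⟨B, hB⟩ := cauchySeq_tendsto_of_complete
    (cauchySeq_of_le_geometric (2 / 3) 1 (by norm_num) dist_sqrtIter_le)
  have hBn : ‖B‖ ≤ 2 / 3 := le_of_tendsto' hB.norm norm_sqrtIter_le
  have hBe : B = (1 / 2 : ℂ) • ((1 / 9 : ℂ) • adj 4 + B * B) := by
    refine tendsto_nhds_unique (hB.comp (tendsto_add_atTop_nat 1)) ?_
    simp only [Function.comp_def, sqrtIter_succ]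
    exact ((tendsto_const_nhds.add (hB.mul hB)).const_smul _)
  let β : (Fin 4 → ℝ) → ℝ := fun ξ => 1 - √(1 - adjSymbol 4 ξ / 9)
  have hs : ∀ ξ, |adjSymbol 4 ξ| ≤ 8 := fun ξ => (abs_adjSymbol_le 4 ξ).trans (by norm_num)
  have hβ : ∀ ξ, 2 * β ξ = adjSymbol 4 ξ / 9 + β ξ ^ 2 ∧ |β ξ| ≤ 2 / 3 := by
    intro ξ
    have h := abs_le.1 (hs ξ)
    have h₁ : √(1 - adjSymbol 4 ξ / 9) ^ 2 = 1 - adjSymbol 4 ξ / 9 := sq_sqrt (by linarith)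
    have h₂ := sqrt_nonneg (1 - adjSymbol 4 ξ / 9)
    refine ⟨by simp only [β]; linarith, ?_⟩
    rw [abs_le]
    constructor
    · simp only [β]; nlinarith
    · simp only [β]; nlinarith
  have hsym : HasSymbol B fun ξ => (β ξ : ℂ) := by
    refine HasSymbol.of_tendsto (fun n => HasSymbol.aeval_adj (sqrtPoly n)) (2 / 3)
      (fun n ξ => (norm_sqrtPoly_eval_sub_le (hβ ξ).1 (hβ ξ).2 (hs ξ) n).1) hB (fun ξ => ?_) ?_
    · rw [tendsto_iff_norm_sub_tendsto_zero]
      exact squeeze_zero (fun _ => norm_nonneg _)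
        (fun n => (norm_sqrtPoly_eval_sub_le (hβ ξ).1 (hβ ξ).2 (hs ξ) n).2)
        (tendsto_pow_atTop_nhds_zero_of_lt_one (by norm_num) (by norm_num))
    · have := continuous_adjSymbol 4
      simp only [β]; fun_prop
  refine ⟨(3 : ℂ) • (1 + (-1 : ℂ) • B), ?_, ?_, ?_, ?_⟩
  · convert (HasSymbol.one.add (hsym.smul (-1))).smul 3 using 2 with ξ
    have : omegaKG 4 ξ = 3 * (1 - β ξ) := by
      have h := abs_le.1 (hs ξ)
      rw [omegaKG_four, show 9 - adjSymbol 4 ξ = 3 ^ 2 * (1 - adjSymbol 4 ξ / 9) by ring,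
        sqrt_mul (by norm_num), sqrt_sq (by norm_num)]
      simp [β]
    rw [this]; push_cast; ring
  · have h : (3 : ℂ) • (1 + (-1 : ℂ) • B) * (3 : ℂ) • (1 + (-1 : ℂ) • B)
        = (9 : ℂ) • (1 + B * B - (2 : ℂ) • B) := by
      rw [smul_mul_smul_comm]
      norm_num
      rw [two_smul]
      noncomm_ring
    rw [h]
    nth_rewrite 3 [hBe]
    simp only [smul_smul, smul_add, smul_sub]
    norm_num
  · have h := norm_add_le 1 ((-1 : ℂ) • B)
    rw [norm_smul] at h ⊢
    have h₁ : ‖(1 : LatticeL2 4 →L[ℂ] LatticeL2 4)‖ ≤ 1 := ContinuousLinearMap.norm_id_le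
    norm_num at h ⊢
    linarith
  · refine ((ColumnBound.one.add
      ((ColumnBound.of_tendsto columnBound_sqrtIter hB).smul (-1))).smul 3).mono ?_
    norm_num

lemma sqrtOneSubLap_eq {H : LatticeL2 4 →L[ℂ] LatticeL2 4}
    (hH : HasSymbol H fun ξ => (omegaKG 4 ξ : ℂ)) (f : LatticeL2 4) (x : Fin 4 → ℤ) :
    sqrtOneSubLap 4 f x = H f x := by
  rw [← (hasSum_apply H f x).tsum_eq, sqrtOneSubLap]
  simp_rw [multKernel_eq_symbolKernel, ← hH.2]

end sqrtPoly

/-- The semigroup `e^{i s t (A - ν)}` generated by the lattice adjacency operator `A`. -/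
def propagator (d : ℕ) (s : ℝ) (ν : ℂ) (t : ℝ) : LatticeL2 d →L[ℂ] LatticeL2 d :=
  Complex.exp (t • (-(s * Complex.I * ν))) •
    NormedSpace.exp (t • ((s * Complex.I : ℂ) • LatticeL2.adj d))

section propagator

open LatticeL2 Filter Topology

variable {d : ℕ} {s : ℝ} {ν : ℂ}

lemma propagator_eq (t : ℝ) : propagator d s ν t = Complex.exp (t • (-(s * Complex.I * ν))) •
    NormedSpace.exp ((((s * t : ℝ) : ℂ) * Complex.I) • adj d) := by
  rw [propagator, ← smul_assoc, Complex.real_smul (x := t) (z := s * Complex.I)]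
  congr 3
  push_cast; ring

lemma norm_exp_phase_le (hs : s * ν.im ≤ 0) {t : ℝ} (ht : 0 ≤ t) :
    ‖Complex.exp (t • (-(s * Complex.I * ν)))‖ ≤ 1 := by
  rw [Complex.norm_exp, Real.exp_le_one_iff]
  simp
  nlinarith

lemma norm_propagator_le (hs : s * ν.im ≤ 0) {t : ℝ} (ht : 0 ≤ t) :
    ‖propagator d s ν t‖ ≤ 1 := by
  rw [propagator_eq, norm_smul]
  exact mul_le_one₀ (norm_exp_phase_le hs ht) (norm_nonneg _) (norm_exp_smul_I_adj_le _)

lemma norm_propagator_delta_apply_le (hs : s * ν.im ≤ 0) {t : ℝ} (ht : 0 ≤ t)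
    (x y : Fin d → ℤ) :
    ‖propagator d s ν t (delta y) x‖ ≤ ∏ j, ‖latticeKernel (s * t) (x j - y j)‖ := by
  rw [← norm_exp_smul_I_adj_delta_apply, propagator_eq]
  refine (norm_mul_le _ _).trans ?_
  exact mul_le_of_le_one_left (norm_nonneg _) (norm_exp_phase_le hs ht)

lemma hasDerivAt_propagator (t : ℝ) :
    HasDerivAt (propagator d s ν)
      (propagator d s ν t * ((s * Complex.I : ℂ) • (adj d - ν • 1))) t := by
  have h₁ : HasDerivAt (fun t : ℝ => Complex.exp (t • (-(s * Complex.I * ν))))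
      (Complex.exp (t • (-(s * Complex.I * ν))) * (-(s * Complex.I * ν))) t := by
    have := (hasDerivAt_id t).smul_const (-(s * Complex.I * ν))
    rw [one_smul] at this
    exact this.cexp
  have h₂ := hasDerivAt_exp_smul_const (𝕂 := ℝ) ((s * Complex.I : ℂ) • adj d) t
  refine (h₁.smul h₂).congr_deriv ?_
  rw [propagator, smul_mul_assoc, smul_sub, mul_sub, smul_sub, smul_smul _ ν, 
    mul_smul_comm _ _ (1 : LatticeL2 d →L[ℂ] LatticeL2 d), mul_one, smul_smul, mul_neg, neg_smul, sub_eq_add_neg]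
  rfl

lemma continuous_propagator : Continuous (propagator d s ν) :=
  continuous_iff_continuousAt.2 fun t => (hasDerivAt_propagator t).continuousAt

/-- The time integral of the propagator over `[a, b]`. -/
def propagatorIntegral (d : ℕ) (s : ℝ) (ν : ℂ) (a b : ℝ) : LatticeL2 d →L[ℂ] LatticeL2 d :=
  ∫ t in a..b, propagator d s ν t

lemma propagatorIntegral_apply (a b : ℝ) (f : LatticeL2 d) (x : Fin d → ℤ) :
    propagatorIntegral d s ν a b f x = ∫ t in a..b, propagator d s ν t f x :=
  (((eval x).comp (ContinuousLinearMap.apply ℂ _ f)).intervalIntegral_comp_comm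
    (continuous_propagator.intervalIntegrable a b)).symm

lemma propagatorIntegral_add (a b c : ℝ) :
    propagatorIntegral d s ν a b + propagatorIntegral d s ν b c = propagatorIntegral d s ν a c :=
  intervalIntegral.integral_add_adjacent_intervals
    (continuous_propagator.intervalIntegrable _ _) (continuous_propagator.intervalIntegrable _ _)

lemma norm_propagatorIntegral_le (hs : s * ν.im ≤ 0) {a b : ℝ} (ha : 0 ≤ a) (hab : a ≤ b) :
    ‖propagatorIntegral d s ν a b‖ ≤ b - a := by
  have := intervalIntegral.norm_integral_le_of_norm_le_const (a := a) (b := b) (C := 1)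
    (f := propagator d s ν) fun t ht => norm_propagator_le hs (by
      rw [Set.uIoc_of_le hab] at ht; exact ha.trans ht.1.le)
  rwa [one_mul, abs_of_nonneg (sub_nonneg.2 hab)] at this

lemma norm_propagatorIntegral_delta_apply_le (hs : s * ν.im ≤ 0) {a b : ℝ} (ha : 0 ≤ a)
    (hab : a ≤ b) (x y : Fin d → ℤ) :
    ‖propagatorIntegral d s ν a b (delta y) x‖
      ≤ ∫ t in a..b, ∏ j, ‖latticeKernel (s * t) (x j - y j)‖ := by
  rw [propagatorIntegral_apply]
  refine intervalIntegral.norm_integral_le_of_norm_le hab (Eventually.of_forall fun t ht =>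
    norm_propagator_delta_apply_le hs (ha.trans ht.1.le) x y) ?_
  refine (continuous_finsetProd _ fun j _ => ?_).intervalIntegrable _ _
  exact ((continuous_latticeKernel _).comp (continuous_const.mul continuous_id)).norm

/-- Duhamel's formula for the propagator. -/
lemma propagator_apply_sub (T : ℝ) (f : LatticeL2 d) :
    propagator d s ν T f - f
      = propagatorIntegral d s ν 0 T ((s * Complex.I : ℂ) • (adj d f - ν • f)) := by
  have h := intervalIntegral.integral_eq_sub_of_hasDerivAt (a := 0) (b := T)
    (fun t _ => hasDerivAt_propagator (d := d) (s := s) (ν := ν) t)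
    ((continuous_propagator.mul continuous_const).intervalIntegrable _ _)
  have h₀ : propagator d s ν 0 = 1 := by simp [propagator]
  rw [h₀] at h
  have h₁ := congr_arg (fun S : LatticeL2 d →L[ℂ] LatticeL2 d => S f) h
  have h₂ : (∫ t in (0:ℝ)..T, propagator d s ν t * ((s * Complex.I : ℂ) • (adj d - ν • 1)))
      = propagatorIntegral d s ν 0 T * ((s * Complex.I : ℂ) • (adj d - ν • 1)) :=
    ((ContinuousLinearMap.mul ℂ (LatticeL2 d →L[ℂ] LatticeL2 d)).flip
      ((s * Complex.I : ℂ) • (adj d - ν • 1))).intervalIntegral_comp_comm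
      (continuous_propagator.intervalIntegrable _ _)
  rw [h₂] at h₁
  exact h₁.symm

lemma tendsto_latticeKernel (hs : |s| = 1) (n : ℤ) :
    Tendsto (fun t : ℝ => ‖latticeKernel (s * t) n‖) atTop (𝓝 0) := by
  obtain ⟨C, hC, h⟩ := exists_sq_norm_latticeKernel_le
  have hsq : Tendsto (fun t : ℝ => ‖latticeKernel (s * t) n‖ ^ 2) atTop (𝓝 0) := by
    refine squeeze_zero' (Eventually.of_forall fun _ => by positivity) ?_
      (mul_zero C ▸ (tendsto_rpow_neg_atTop (y := 1 / 2) (by norm_num)).const_mul C)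
    filter_upwards [eventually_gt_atTop 0] with t ht
    have hs0 : s ≠ 0 := by rintro rfl; simp at hs
    have := h (s * t) n (mul_ne_zero hs0 ht.ne')
    rwa [abs_mul, hs, one_mul, abs_of_pos ht] at this
  have := hsq.sqrt
  simpa [Real.sqrt_sq] using this

lemma tendsto_propagator_apply (hd : 0 < d) (hs : |s| = 1) (hν : s * ν.im ≤ 0) (f : LatticeL2 d)
    (x : Fin d → ℤ) : Tendsto (fun t => propagator d s ν t f x) atTop (𝓝 0) := by
  have hδ : ∀ y, Tendsto (fun t => propagator d s ν t (delta y) x) atTop (𝓝 0) := by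
    intro y
    refine squeeze_zero_norm' ?_ (tendsto_latticeKernel hs (x ⟨0, hd⟩ - y ⟨0, hd⟩))
    filter_upwards [eventually_ge_atTop 0] with t ht
    refine (norm_propagator_delta_apply_le hν ht x y).trans ?_
    rw [← Finset.mul_prod_erase _ _ (Finset.mem_univ (⟨0, hd⟩ : Fin d))]
    exact mul_le_of_le_one_right (norm_nonneg _)
      (Finset.prod_le_one (fun _ _ => norm_nonneg _) fun _ _ => norm_latticeKernel_le_one _ _)
  rw [Metric.tendsto_atTop]
  intro ε hε
  obtain ⟨F, hF⟩ := (Metric.tendsto_atTop.1 (hasSum_smul_delta f)) (ε / 2) (half_pos hε)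
  have hg : Tendsto (fun t => propagator d s ν t (∑ y ∈ F, f y • delta y) x) atTop (𝓝 0) := by
    have : Tendsto (fun t => ∑ y ∈ F, f y * propagator d s ν t (delta y) x) atTop (𝓝 0) := by
      simpa using tendsto_finsetSum F fun y _ => (hδ y).const_mul (f y)
    refine this.congr fun t => ?_
    rw [← eval_apply, map_sum, map_sum]
    simp [eval_apply]
  obtain ⟨N, hN⟩ := (Metric.tendsto_atTop.1 hg) (ε / 2) (half_pos hε)
  refine ⟨max N 0, fun t ht => ?_⟩
  have h₁ := hN t ((le_max_left _ _).trans ht)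
  have h₂ := hF F le_rfl
  rw [dist_zero_right] at h₁ ⊢
  rw [dist_comm, dist_eq_norm] at h₂
  have h₃ : ‖propagator d s ν t (f - ∑ y ∈ F, f y • delta y) x‖ < ε / 2 := by
    refine lt_of_le_of_lt ?_ h₂
    refine (norm_apply_le _ _).trans ?_
    exact (ContinuousLinearMap.le_of_opNorm_le _
      (norm_propagator_le hν ((le_max_right _ _).trans ht)) _).trans_eq (one_mul _)
  have h₄ : propagator d s ν t f x = propagator d s ν t (f - ∑ y ∈ F, f y • delta y) x
      + propagator d s ν t (∑ y ∈ F, f y • delta y) x := by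
    rw [map_sub]
    exact (sub_add_cancel _ _).symm
  rw [h₄]
  exact (norm_add_le _ _).trans_lt (by linarith)

end propagator

/-- The entire function `ζ ↦ w ^ (σ ζ)`, vanishing identically for `w = 0`. -/
def weightPow (σ w : ℝ) (ζ : ℂ) : ℂ := if w = 0 then 0 else Complex.exp (σ * ζ * Real.log w)

section interpolation

open Complex.HadamardThreeLines

variable {σ w : ℝ}

lemma differentiable_weightPow : Differentiable ℂ (weightPow σ w) := by
  unfold weightPow
  split_ifs <;> fun_prop

lemma norm_weightPow_le (hw : 0 ≤ w) (ζ : ℂ) :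
    ‖weightPow σ w ζ‖ ≤ w ^ (σ * ζ.re) := by
  rw [weightPow]
  split_ifs with h
  · rw [norm_zero]; positivity
  · rw [Complex.norm_exp, rpow_def_of_pos (hw.lt_of_ne (Ne.symm h))]
    simp [mul_comm]

lemma weightPow_inv (hσ : 0 < σ) (hw : 0 ≤ w) : weightPow σ w ((1 / σ : ℝ) : ℂ) = w := by
  rw [weightPow]
  split_ifs with h
  · simp [h]
  · rw [← Complex.ofReal_mul, mul_one_div_cancel hσ.ne', Complex.ofReal_one, one_mul,
      ← Complex.ofReal_exp, Real.exp_log (hw.lt_of_ne (Ne.symm h))]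

/-- Riesz--Thorin type interpolation for a matrix that is bounded on `ℓ²` and has bounded entries,
when sandwiched between `ℓ^{2σ}` weights. -/
theorem norm_weighted_bilinear_le {ι : Type*} (F G : Finset ι) (m : ι → ι → ℂ) (w : ι → ℝ)
    (hw : ∀ x, 0 ≤ w x) {A₁ A₂ S σ : ℝ} (hσ : 1 ≤ σ) (hA₁ : 0 ≤ A₁) (hA₂ : 0 ≤ A₂) (hS : 0 ≤ S)
    (h₂ : ∀ u v : ι → ℂ, ‖∑ x ∈ F, ∑ z ∈ G, u x * m x z * v z‖
      ≤ A₂ * (√(∑ x ∈ F, ‖u x‖ ^ 2) * √(∑ z ∈ G, ‖v z‖ ^ 2)))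
    (h₁ : ∀ x z, ‖m x z‖ ≤ A₁) (hF : ∑ x ∈ F, w x ^ (2 * σ) ≤ S)
    (hG : ∑ x ∈ G, w x ^ (2 * σ) ≤ S) (u v : ι → ℂ) :
    ‖∑ x ∈ F, ∑ z ∈ G, u x * w x * m x z * (w z * v z)‖
      ≤ A₂ ^ (1 - 1 / σ) * (A₁ * S) ^ (1 / σ)
        * (√(∑ x ∈ F, ‖u x‖ ^ 2) * √(∑ z ∈ G, ‖v z‖ ^ 2)) := by
  have hσ0 : 0 < σ := by linarith
  set N := √(∑ x ∈ F, ‖u x‖ ^ 2) * √(∑ z ∈ G, ‖v z‖ ^ 2) with hN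
  have hN0 : 0 ≤ N := by positivity
  let f : ℂ → ℂ := fun ζ => ∑ x ∈ F, ∑ z ∈ G,
    u x * weightPow σ (w x) ζ * m x z * (weightPow σ (w z) ζ * v z)
  have hf : Differentiable ℂ f := by
    refine Differentiable.fun_sum fun x _ => Differentiable.fun_sum fun z _ => ?_
    exact (((differentiable_weightPow.const_mul _).mul_const _).mul
      (differentiable_weightPow.mul_const _))
  have hθ0 : 0 ≤ 1 / σ := by positivity
  have hθ1 : 1 / σ ≤ 1 := by rw [div_le_one hσ0]; exact hσ
  have hmem : ((1 / σ : ℝ) : ℂ) ∈ verticalClosedStrip 0 1 := by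
    rw [verticalClosedStrip, Set.mem_preimage, Complex.ofReal_re]
    exact ⟨hθ0, hθ1⟩
  have hbdd : BddAbove (norm ∘ f '' verticalClosedStrip 0 1) := by
    have hmax : ∀ x, ∀ ζ ∈ verticalClosedStrip 0 1, ‖weightPow σ (w x) ζ‖ ≤ max 1 (w x) ^ σ := by
      intro x ζ hζ
      have hζ' : ζ.re ∈ Set.Icc (0:ℝ) 1 := hζ
      refine (norm_weightPow_le (hw x) ζ).trans ?_
      refine (rpow_le_rpow (hw x) (le_max_right 1 _) (mul_nonneg hσ0.le hζ'.1)).trans ?_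
      exact rpow_le_rpow_of_exponent_le (le_max_left _ _) (by nlinarith [hζ'.2])
    refine ⟨∑ x ∈ F, ∑ z ∈ G, ‖u x‖ * max 1 (w x) ^ σ * ‖m x z‖ * (max 1 (w z) ^ σ * ‖v z‖), ?_⟩
    rintro _ ⟨ζ, hζ, rfl⟩
    refine (norm_sum_le _ _).trans (Finset.sum_le_sum fun x _ => (norm_sum_le _ _).trans
      (Finset.sum_le_sum fun z _ => ?_))
    simp only [norm_mul]
    have h1 := hmax x ζ hζ
    have h2 := hmax z ζ hζ
    gcongr
  have hleft : ∀ ζ ∈ Complex.re ⁻¹' {0}, ‖f ζ‖ ≤ A₂ * N := by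
    intro ζ hζ
    have hζ' : ζ.re = 0 := hζ
    have hle : ∀ x, ‖weightPow σ (w x) ζ‖ ≤ 1 := fun x => by
      simpa [hζ'] using norm_weightPow_le (hw x) ζ
    refine (h₂ (fun x => u x * weightPow σ (w x) ζ) fun z => weightPow σ (w z) ζ * v z).trans ?_
    refine mul_le_mul_of_nonneg_left ?_ hA₂
    rw [hN]
    gcongr with x _ z _
    · rw [norm_mul]; exact mul_le_of_le_one_right (norm_nonneg _) (hle x)
    · rw [norm_mul]; exact mul_le_of_le_one_left (norm_nonneg _) (hle z)
  have hright : ∀ ζ ∈ Complex.re ⁻¹' {1}, ‖f ζ‖ ≤ A₁ * S * N := by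
    intro ζ hζ
    have hζ' : ζ.re = 1 := hζ
    have hle : ∀ x, ‖weightPow σ (w x) ζ‖ ≤ w x ^ σ := fun x => by
      simpa [hζ'] using norm_weightPow_le (hw x) ζ
    have hcs : ∀ (E : Finset ι) (g : ι → ℂ), ∑ x ∈ E, w x ^ (2 * σ) ≤ S →
        ∑ x ∈ E, ‖g x‖ * w x ^ σ ≤ √(∑ x ∈ E, ‖g x‖ ^ 2) * √S := by
      intro E g hE
      refine (Real.sum_mul_le_sqrt_mul_sqrt E _ _).trans ?_
      have : ∀ x, (w x ^ σ) ^ 2 = w x ^ (2 * σ) := fun x => by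
        rw [← rpow_natCast, ← rpow_mul (hw x), mul_comm]; norm_num
      simp_rw [this]
      gcongr
    calc ‖f ζ‖ ≤ ∑ x ∈ F, ∑ z ∈ G, ‖u x‖ * w x ^ σ * A₁ * (w z ^ σ * ‖v z‖) := by
          refine (norm_sum_le _ _).trans (Finset.sum_le_sum fun x _ => (norm_sum_le _ _).trans
            (Finset.sum_le_sum fun z _ => ?_))
          simp only [norm_mul]
          have h1 := hle x
          have h2 := hle z
          have h3 := h₁ x z
          have h4 := rpow_nonneg (hw x) σ
          gcongr
      _ = A₁ * ((∑ x ∈ F, ‖u x‖ * w x ^ σ) * ∑ z ∈ G, ‖v z‖ * w z ^ σ) := by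
          rw [Finset.sum_mul_sum, Finset.mul_sum]
          refine Finset.sum_congr rfl fun x _ => ?_
          rw [Finset.mul_sum]
          exact Finset.sum_congr rfl fun z _ => by ring
      _ ≤ A₁ * ((√(∑ x ∈ F, ‖u x‖ ^ 2) * √S) * (√(∑ z ∈ G, ‖v z‖ ^ 2) * √S)) := by
          have h1 := hcs F u hF
          have h2 := hcs G v hG
          have h3 : 0 ≤ ∑ z ∈ G, ‖v z‖ * w z ^ σ :=
            Finset.sum_nonneg fun z _ => mul_nonneg (norm_nonneg _) (rpow_nonneg (hw z) σ)
          gcongr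
      _ = A₁ * S * N := by
          rw [hN]
          linear_combination A₁ * √(∑ x ∈ F, ‖u x‖ ^ 2) * √(∑ z ∈ G, ‖v z‖ ^ 2) * mul_self_sqrt hS
  have key := norm_le_interp_of_mem_verticalClosedStrip₀₁' f hmem hf.diffContOnCl hbdd hleft hright
  rw [Complex.ofReal_re, mul_rpow hA₂ hN0, mul_rpow (mul_nonneg hA₁ hS) hN0] at key
  have hNN : N ^ (1 - 1 / σ) * N ^ (1 / σ) = N := by
    rw [← rpow_add_of_nonneg hN0 (by linarith) hθ0, sub_add_cancel, rpow_one]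
  calc _ = ‖f ((1 / σ : ℝ) : ℂ)‖ := by
        simp only [f, weightPow_inv hσ0 (hw _)]
    _ ≤ _ := key
    _ = A₂ ^ (1 - 1 / σ) * (A₁ * S) ^ (1 / σ) * (N ^ (1 - 1 / σ) * N ^ (1 / σ)) := by ring
    _ = _ := by rw [hNN]

end interpolation

namespace LatticeL2

variable {d : ℕ}

lemma norm_sum_smul_delta (G : Finset (Fin d → ℤ)) (v : (Fin d → ℤ) → ℂ) :
    ‖∑ z ∈ G, v z • (delta z : LatticeL2 d)‖ = √(∑ z ∈ G, ‖v z‖ ^ 2) := by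
  classical
  have happ : ∀ x, (∑ z ∈ G, v z • (delta z : LatticeL2 d) : LatticeL2 d) x
      = if x ∈ G then v x else 0 := by
    intro x
    rw [← eval_apply, map_sum]
    simp [eval_apply, delta_apply]
  rw [eq_comm, Real.sqrt_eq_iff_eq_sq (by positivity) (norm_nonneg _), norm_sq_eq_tsum,
    tsum_eq_sum (s := G) fun x hx => by rw [happ, if_neg hx]; simp]
  exact Finset.sum_congr rfl fun x hx => by rw [happ, if_pos hx]

lemma norm_sum_mul_apply_le (F : Finset (Fin d → ℤ)) (u : (Fin d → ℤ) → ℂ) (f : LatticeL2 d) :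
    ‖∑ x ∈ F, u x * f x‖ ≤ √(∑ x ∈ F, ‖u x‖ ^ 2) * ‖f‖ := by
  refine (norm_sum_le _ _).trans ?_
  simp_rw [norm_mul]
  refine (Real.sum_mul_le_sqrt_mul_sqrt F _ _).trans ?_
  gcongr
  exact Real.sqrt_le_iff.2 ⟨norm_nonneg _, sum_norm_sq_le f F⟩

lemma norm_weighted_pairing_le {T : LatticeL2 d →L[ℂ] LatticeL2 d} {w : (Fin d → ℤ) → ℝ}
    (hw : ∀ x, 0 ≤ w x) {A₁ A₂ S σ : ℝ} (hσ : 1 ≤ σ) (hA₁ : 0 ≤ A₁) (hA₂ : 0 ≤ A₂)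
    (h₂ : ‖T‖ ≤ A₂) (h₁ : ∀ x z, ‖T (delta z) x‖ ≤ A₁)
    (hS : ∀ F : Finset (Fin d → ℤ), ∑ x ∈ F, w x ^ (2 * σ) ≤ S) (F : Finset (Fin d → ℤ))
    (u v : (Fin d → ℤ) → ℂ) {f : LatticeL2 d} (hf : ∀ x, f x = w x * v x) {M : ℝ}
    (hv : ∀ G : Finset (Fin d → ℤ), √(∑ z ∈ G, ‖v z‖ ^ 2) ≤ M) :
    ‖∑ x ∈ F, u x * w x * T f x‖
      ≤ A₂ ^ (1 - 1 / σ) * (A₁ * S) ^ (1 / σ) * (√(∑ x ∈ F, ‖u x‖ ^ 2) * M) := by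
  have hS0 : 0 ≤ S := by simpa using hS ∅
  have hlim : HasSum (fun z => ∑ x ∈ F, u x * w x * T (delta z) x * (w z * v z))
      (∑ x ∈ F, u x * w x * T f x) := by
    refine hasSum_sum fun x _ => ?_
    have := (hasSum_apply T f x).mul_left (u x * w x)
    simpa only [hf, mul_assoc] using this
  refine le_of_tendsto hlim.norm (Filter.Eventually.of_forall fun G => ?_)
  rw [Finset.sum_comm]
  have hbil : ∀ u v : (Fin d → ℤ) → ℂ, ‖∑ x ∈ F, ∑ z ∈ G, u x * T (delta z) x * v z‖
      ≤ A₂ * (√(∑ x ∈ F, ‖u x‖ ^ 2) * √(∑ z ∈ G, ‖v z‖ ^ 2)) := by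
    intro u v
    have h : ∑ x ∈ F, ∑ z ∈ G, u x * T (delta z) x * v z
        = ∑ x ∈ F, u x * T (∑ z ∈ G, v z • delta z) x := by
      refine Finset.sum_congr rfl fun x _ => ?_
      rw [← eval_apply x (T _), map_sum, map_sum, Finset.mul_sum]
      refine Finset.sum_congr rfl fun z _ => ?_
      simp [eval_apply]; ring
    rw [h]
    refine (norm_sum_mul_apply_le F u _).trans ?_
    have := T.le_of_opNorm_le h₂ (∑ z ∈ G, v z • delta z)
    rw [norm_sum_smul_delta] at this
    calc _ ≤ √(∑ x ∈ F, ‖u x‖ ^ 2) * (A₂ * √(∑ z ∈ G, ‖v z‖ ^ 2)) := by gcongr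
      _ = _ := by ring
  refine (norm_weighted_bilinear_le F G (fun x z => T (delta z) x) w hw hσ hA₁ hA₂ hS0 hbil h₁
    (hS F) (hS G) u v).trans ?_
  have := hv G
  gcongr


lemma propagatorIntegral_two_pow {d : ℕ} {s : ℝ} {ν : ℂ} (N : ℕ) :
    propagatorIntegral d s ν 0 (2 ^ N) = propagatorIntegral d s ν 0 1
      + ∑ k ∈ Finset.range N, propagatorIntegral d s ν (2 ^ k) (2 * 2 ^ k) := by
  induction N with
  | zero => simp
  | succ N ih =>
    rw [Finset.sum_range_succ, ← add_assoc, ← ih, propagatorIntegral_add, pow_succ']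

/-- Uniform weighted resolvent estimate in dimension four: truncated Duhamel integrals are bounded
between weighted spaces, uniformly in the truncation and in the spectral parameter. -/
theorem exists_norm_weighted_propagatorIntegral_le {σ : ℝ} (hσ₁ : 1 < σ) (hσ₂ : σ < 3 / 2) {c : ℝ}
    (hc : 0 ≤ c) : ∃ K > 0, ∀ (s : ℝ) (ν : ℂ) (R : LatticeL2 4 →L[ℂ] LatticeL2 4), |s| = 1 →
      s * ν.im ≤ 0 → ‖R‖ ≤ c → ColumnBound R c →
      ∀ (w : (Fin 4 → ℤ) → ℝ) (ε : ℝ), (∀ x, 0 ≤ w x) → 0 ≤ ε →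
      (∀ F : Finset (Fin 4 → ℤ), ∑ x ∈ F, w x ^ (2 * σ) ≤ ε ^ σ) →
      ∀ (u v : (Fin 4 → ℤ) → ℂ) (f : LatticeL2 4) (M : ℝ), (∀ x, f x = w x * v x) →
      (∀ G : Finset (Fin 4 → ℤ), √(∑ z ∈ G, ‖v z‖ ^ 2) ≤ M) →
      ∀ (N : ℕ) (F : Finset (Fin 4 → ℤ)),
        ‖∑ x ∈ F, u x * w x * propagatorIntegral 4 s ν 0 (2 ^ N) (R f) x‖
          ≤ K * ε * (√(∑ x ∈ F, ‖u x‖ ^ 2) * M) := by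
  set κ : ℝ := (3 / 2 - σ) / 2 with hκ
  obtain ⟨C, hC, hdecay⟩ := exists_integral_prod_latticeKernel_le (κ := κ)
    (by linarith) (by linarith)
  set θ : ℝ := 1 / σ with hθ
  have hθ0 : 0 < θ := by positivity
  have hσθ : σ * θ = 1 := mul_one_div_cancel (by linarith)
  set r : ℝ := 1 - θ + (κ - 1 / 2) * θ with hr
  have hr0 : r < 0 := by nlinarith
  set q : ℝ := 2 ^ r with hq
  have hq0 : 0 < q := by positivity
  have hq1 : q < 1 := rpow_lt_one_of_one_lt_of_neg (by norm_num) hr0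
  refine ⟨(c + 1) * (1 + C ^ θ / (1 - q)), ?_, ?_⟩
  · have : 0 < 1 - q := by linarith
    positivity
  intro s ν R hs hν hR hRc w ε hw hε hS u v f M hf hv N F
  have hM : 0 ≤ M := (Real.sqrt_nonneg _).trans (hv ∅)
  set Q := √(∑ x ∈ F, ‖u x‖ ^ 2) * M with hQ
  have hQ0 : 0 ≤ Q := by positivity
  have hεσ : (ε ^ σ) ^ θ = ε := by rw [← rpow_mul hε, hσθ, rpow_one]
  have hcc : c ^ (1 - θ) * c ^ θ = c := by
    rw [← rpow_add_of_nonneg hc (by nlinarith) hθ0.le, sub_add_cancel, rpow_one]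
  have hpiece : ∀ a b A : ℝ, 0 ≤ a → a ≤ b → 0 ≤ A →
      (∀ x y, ‖propagatorIntegral 4 s ν a b (delta y) x‖ ≤ A) →
      ‖∑ x ∈ F, u x * w x * propagatorIntegral 4 s ν a b (R f) x‖
        ≤ (b - a) ^ (1 - θ) * A ^ θ * (c * ε) * Q := by
    intro a b A ha hab hA hker
    have h := norm_weighted_pairing_le (T := propagatorIntegral 4 s ν a b * R) hw hσ₁.le
      (mul_nonneg hA hc) (mul_nonneg (sub_nonneg.2 hab) hc)
      ((norm_mul_le _ _).trans (mul_le_mul (norm_propagatorIntegral_le hν ha hab) hR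
        (norm_nonneg _) (sub_nonneg.2 hab)))
      (fun x z => norm_apply_le_of_kernel_le
        (T := propagatorIntegral 4 s ν a b) (hker x) (hRc z)) hS F u v hf hv
    refine h.trans_eq ?_
    rw [← hθ, mul_rpow (sub_nonneg.2 hab) hc, mul_rpow (mul_nonneg hA hc) (rpow_nonneg hε _),
      mul_rpow hA hc, hεσ]
    linear_combination (b - a) ^ (1 - θ) * A ^ θ * ε * Q * hcc
  have hzero : ‖∑ x ∈ F, u x * w x * propagatorIntegral 4 s ν 0 1 (R f) x‖ ≤ c * ε * Q := by
    refine (hpiece 0 1 1 le_rfl zero_le_one zero_le_one fun x y => ?_).trans_eq (by simp)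
    refine (norm_apply_le _ _).trans ?_
    refine (ContinuousLinearMap.le_of_opNorm_le _
      (norm_propagatorIntegral_le hν le_rfl zero_le_one) _).trans_eq ?_
    rw [norm_delta]; norm_num
  have hk : ∀ k : ℕ, ‖∑ x ∈ F, u x * w x
      * propagatorIntegral 4 s ν (2 ^ k) (2 * 2 ^ k) (R f) x‖ ≤ C ^ θ * (c * ε) * Q * q ^ k := by
    intro k
    have h2k : (0:ℝ) < 2 ^ k := by positivity
    refine (hpiece (2 ^ k) (2 * 2 ^ k) (C * (2 ^ k) ^ (κ - 1 / 2)) h2k.le (by linarith)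
      (by positivity) fun x y => (norm_propagatorIntegral_delta_apply_le hν h2k.le
        (by linarith) x y).trans (hdecay s (2 ^ k) (x - y) hs h2k)).trans_eq ?_
    have h1 : ((2:ℝ) ^ k) ^ (1 - θ) * ((2 ^ k) ^ (κ - 1 / 2)) ^ θ = q ^ k := by
      rw [← rpow_mul h2k.le, ← rpow_add h2k, hq, ← rpow_natCast, ← rpow_mul zero_le_two,
        ← rpow_natCast, ← rpow_mul zero_le_two, mul_comm]
    rw [mul_rpow hC.le (by positivity), show 2 * (2:ℝ) ^ k - 2 ^ k = 2 ^ k by ring, ← h1]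
    ring
  have hsplit : ∑ x ∈ F, u x * w x * propagatorIntegral 4 s ν 0 (2 ^ N) (R f) x
      = ∑ x ∈ F, u x * w x * propagatorIntegral 4 s ν 0 1 (R f) x
        + ∑ k ∈ Finset.range N, ∑ x ∈ F, u x * w x
          * propagatorIntegral 4 s ν (2 ^ k) (2 * 2 ^ k) (R f) x := by
    rw [Finset.sum_comm, ← Finset.sum_add_distrib]
    refine Finset.sum_congr rfl fun x _ => ?_
    rw [← Finset.mul_sum, ← mul_add]
    congr 1
    rw [propagatorIntegral_two_pow, ← eval_apply, add_apply, map_add,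
      sum_apply, map_sum]
    rfl
  rw [hsplit]
  have hgeom : ∑ k ∈ Finset.range N, q ^ k ≤ (1 - q)⁻¹ := by
    rw [← tsum_geometric_of_lt_one hq0.le hq1]
    exact (summable_geometric_of_lt_one hq0.le hq1).sum_le_tsum _ fun _ _ => by positivity
  calc _ ≤ c * ε * Q + ∑ k ∈ Finset.range N, C ^ θ * (c * ε) * Q * q ^ k :=
        (norm_add_le _ _).trans (add_le_add hzero (norm_sum_le_of_le _ fun k _ => hk k))
    _ ≤ c * ε * Q + C ^ θ * (c * ε) * Q * (1 - q)⁻¹ := by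
        rw [← Finset.mul_sum]
        gcongr
    _ = c * (1 + C ^ θ / (1 - q)) * ε * Q := by ring
    _ ≤ (c + 1) * (1 + C ^ θ / (1 - q)) * ε * Q := by
        have : 0 < 1 - q := by linarith
        gcongr
        linarith

end LatticeL2

lemma sum_norm_rpow_le_of_eLpNorm_count_le {ι : Type*} {V : ι → ℂ} {σ ε : ℝ}
    [MeasurableSpace ι] [MeasurableSingletonClass ι] (hσ : 0 < σ) (hε : 0 ≤ ε)
    (hV : eLpNorm V (ENNReal.ofReal σ) Measure.count ≤ ENNReal.ofReal ε) (F : Finset ι) :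
    ∑ x ∈ F, ‖V x‖ ^ σ ≤ ε ^ σ := by
  rw [eLpNorm_eq_lintegral_rpow_enorm_toReal (by simpa using hσ) ENNReal.ofReal_ne_top,
    ENNReal.toReal_ofReal hσ.le, one_div, ENNReal.rpow_inv_le_iff hσ,
    ENNReal.ofReal_rpow_of_nonneg hε hσ.le] at hV
  have h : ∑ x ∈ F, ‖V x‖ₑ ^ σ ≤ ENNReal.ofReal (ε ^ σ) := by
    refine le_trans ?_ hV
    calc ∑ x ∈ F, ‖V x‖ₑ ^ σ = ∫⁻ x in (F : Set ι), ‖V x‖ₑ ^ σ ∂Measure.count := by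
          rw [lintegral_finset]; simp
      _ ≤ _ := setLIntegral_le_lintegral _ _
  have h' : ENNReal.ofReal (∑ x ∈ F, ‖V x‖ ^ σ) ≤ ENNReal.ofReal (ε ^ σ) := by
    rw [ENNReal.ofReal_sum_of_nonneg fun _ _ => by positivity]
    refine le_trans (le_of_eq (Finset.sum_congr rfl fun x _ => ?_)) h
    rw [← ENNReal.ofReal_rpow_of_nonneg (norm_nonneg _) hσ.le, ofReal_norm]
  exact (ENNReal.ofReal_le_ofReal_iff (by positivity)).1 h'

open LatticeL2 Filter Topology

/-- Absence of eigenvalues for the stationary discrete Klein--Gordon equation on `ℤ⁴`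
with a potential small in `ℓ^σ`, `σ ∈ (1, 3/2)`: if `‖V‖_{ℓ^σ} ≤ ε` then
`√(1−Δ)ψ + Vψ = λψ` has no nontrivial solution `ψ ∈ ℓ²(ℤ⁴)`. -/
theorem no_eigenvalues_d4 (σ : ℝ) (hσ₁ : 1 < σ) (hσ₂ : σ < 3/2) :
    ∃ ε > (0:ℝ), ∀ V : (Fin 4 → ℤ) → ℂ,
      eLpNorm V (ENNReal.ofReal σ) Measure.count ≤ ENNReal.ofReal ε →
      ∀ (lam : ℂ) (ψ : (Fin 4 → ℤ) → ℂ), Memℓp ψ 2 →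
        (∀ x, sqrtOneSubLap 4 ψ x + V x * ψ x = lam * ψ x) → ψ = 0 := by
  obtain ⟨H, hHsym, hHH, hHn, hHc⟩ := exists_hasSymbol_omegaKG
  obtain ⟨K, hK, hmain⟩ :=
    exists_norm_weighted_propagatorIntegral_le hσ₁ hσ₂ (c := 11) (by norm_num)
  refine ⟨min 1 (1 / (2 * K)), by positivity, ?_⟩
  set ε := min 1 (1 / (2 * K)) with hε
  have hε0 : 0 < ε := by positivity
  have hε1 : ε ≤ 1 := min_le_left _ _
  have hKε : K * ε ≤ 1 / 2 := by
    calc K * ε ≤ K * (1 / (2 * K)) := mul_le_mul_of_nonneg_left (min_le_right _ _) hK.le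
      _ = 1 / 2 := by field_simp
  intro V hV lam ψ₀ hψ₀ heq
  have hσ0 : 0 < σ := by linarith
  have hVσ := sum_norm_rpow_le_of_eLpNorm_count_le hσ0 hε0.le hV
  have hV1 : ∀ x, ‖V x‖ ≤ 1 := fun x => by
    have h := hVσ {x}
    rw [Finset.sum_singleton] at h
    exact ((Real.rpow_le_rpow_iff (norm_nonneg _) hε0.le hσ0).1 h).trans hε1
  let ψ : LatticeL2 4 := ⟨ψ₀, hψ₀⟩
  have hψ : ∀ x, ψ₀ x = ψ x := fun _ => rfl
  suffices hz : ψ = 0 by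
    ext x
    rw [hψ, hz]; rfl
  let g : LatticeL2 4 := lam • ψ - H ψ
  have hg : ∀ x, g x = V x * ψ x := fun x => by
    have h := heq x
    rw [show sqrtOneSubLap 4 ψ₀ x = H ψ x from sqrtOneSubLap_eq hHsym ψ x] at h
    have h' : g x = lam * ψ x - H ψ x := rfl
    rw [h', ← hψ, ← h]; ring
  by_contra hψ0
  have hψn : 0 < ‖ψ‖ := norm_pos_iff.2 hψ0
  have hgn : ‖g‖ ≤ ‖ψ‖ := by
    rw [← sq_le_sq₀ (norm_nonneg _) (norm_nonneg _), norm_sq_eq_tsum, norm_sq_eq_tsum]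
    refine (summable_norm_sq g).tsum_le_tsum (fun x => ?_) (summable_norm_sq ψ)
    rw [hg, norm_mul]
    gcongr
    exact mul_le_of_le_one_left (norm_nonneg _) (hV1 x)
  have hlam : ‖lam‖ ≤ 6 := by
    have h : ‖lam • ψ‖ ≤ 5 * ‖ψ‖ + ‖ψ‖ := by
      rw [show lam • ψ = H ψ + g by simp [g]]
      exact (norm_add_le _ _).trans (add_le_add (H.le_of_opNorm_le hHn ψ) hgn)
    rw [norm_smul] at h
    exact le_of_mul_le_mul_right (by linarith) hψn
  let R : LatticeL2 4 →L[ℂ] LatticeL2 4 := H + lam • 1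
  have hRn : ‖R‖ ≤ 11 := by
    have h := norm_add_le H (lam • (1 : LatticeL2 4 →L[ℂ] LatticeL2 4))
    have h₁ : ‖(1 : LatticeL2 4 →L[ℂ] LatticeL2 4)‖ ≤ 1 := ContinuousLinearMap.norm_id_le
    rw [norm_smul] at h
    have : ‖R‖ ≤ ‖H‖ + ‖lam‖ * ‖(1 : LatticeL2 4 →L[ℂ] LatticeL2 4)‖ := h
    nlinarith [norm_nonneg lam]
  have hRc : ColumnBound R 11 := (hHc.add (ColumnBound.one.smul lam)).mono (by linarith)
  set ν : ℂ := 9 - lam ^ 2 with hν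
  have hRg : R g = adj 4 ψ - ν • ψ := by
    have h₁ : H (H ψ) = (9 : ℂ) • ψ - adj 4 ψ :=
      congr_arg (fun S : LatticeL2 4 →L[ℂ] LatticeL2 4 => S ψ) hHH
    have h₂ : R g = H g + lam • g := rfl
    rw [h₂, show g = lam • ψ - H ψ from rfl, map_sub, map_smul, h₁, hν]
    module
  obtain ⟨s, hs, hsν⟩ : ∃ s : ℝ, |s| = 1 ∧ s * ν.im ≤ 0 := by
    rcases le_total ν.im 0 with h | h
    · exact ⟨1, by simp, by simpa using h⟩
    · exact ⟨-1, by simp, by simpa using h⟩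
  have hduh : ∀ N : ℕ, ∀ x, propagator 4 s ν (2 ^ N) ψ x - ψ x
      = s * Complex.I * propagatorIntegral 4 s ν 0 (2 ^ N) (R g) x := by
    intro N x
    have h := propagator_apply_sub (s := s) (ν := ν) (2 ^ N) ψ
    rw [← hRg, map_smul] at h
    exact congr_arg (fun f : LatticeL2 4 => f x) h
  have hdec : ∀ x, Tendsto (fun N : ℕ => propagator 4 s ν (2 ^ N) ψ x) atTop (𝓝 0) := fun x =>
    (tendsto_propagator_apply (by norm_num) hs hsν ψ x).comp
      (tendsto_pow_atTop_atTop_of_one_lt (by norm_num))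
  have hlim : ∀ x, Tendsto (fun N : ℕ => s * Complex.I
      * propagatorIntegral 4 s ν 0 (2 ^ N) (R g) x) atTop (𝓝 (-ψ x)) := by
    intro x
    have h := (hdec x).sub_const (ψ x)
    rw [zero_sub] at h
    exact h.congr fun N => hduh N x
  let w : (Fin 4 → ℤ) → ℝ := fun x => √‖V x‖
  have hw0 : ∀ x, 0 ≤ w x := fun x => Real.sqrt_nonneg _
  have hw1 : ∀ x, w x ≤ 1 := fun x => Real.sqrt_le_one.2 (hV1 x)
  have hwσ : ∀ F : Finset (Fin 4 → ℤ), ∑ x ∈ F, w x ^ (2 * σ) ≤ ε ^ σ := fun F => by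
    refine le_trans (le_of_eq (Finset.sum_congr rfl fun x _ => ?_)) (hVσ F)
    rw [rpow_mul (hw0 x), rpow_two, Real.sq_sqrt (norm_nonneg _)]
  let φ : (Fin 4 → ℤ) → ℂ := fun x => w x * ψ x
  have hφψ : ∀ x, ‖φ x‖ ^ 2 ≤ ‖ψ x‖ ^ 2 := fun x => by
    simp only [φ, norm_mul, Complex.norm_real, Real.norm_eq_abs, abs_of_nonneg (hw0 x)]
    gcongr
    exact mul_le_of_le_one_left (norm_nonneg _) (hw1 x)
  have hφs : Summable fun x => ‖φ x‖ ^ 2 :=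
    Summable.of_nonneg_of_le (fun _ => by positivity) hφψ (summable_norm_sq ψ)
  let v : (Fin 4 → ℤ) → ℂ := fun x => V x / ‖V x‖ * φ x
  have hgv : ∀ x, g x = w x * v x := fun x => by
    rw [hg]
    simp only [v, φ]
    have hww : (w x : ℂ) * w x = ‖V x‖ := by
      rw [← Complex.ofReal_mul]; congr 1; exact Real.mul_self_sqrt (norm_nonneg _)
    have hVV : V x / ‖V x‖ * ‖V x‖ = V x := by
      by_cases h : V x = 0
      · simp [h]
      · exact div_mul_cancel₀ _ (by simpa using h)
    linear_combination (-(ψ x) : ℂ) * hVV - V x / ‖V x‖ * ψ x * hww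
  have hvφ : ∀ x, ‖v x‖ ≤ ‖φ x‖ := fun x => by
    simp only [v, norm_mul, norm_div, Complex.norm_real, norm_norm]
    exact mul_le_of_le_one_left (norm_nonneg _) (div_self_le_one _)
  set M := √(∑' x, ‖φ x‖ ^ 2) with hM
  have hφM : ∀ G : Finset (Fin 4 → ℤ), √(∑ z ∈ G, ‖φ z‖ ^ 2) ≤ M := fun G =>
    Real.sqrt_le_sqrt (hφs.sum_le_tsum _ fun _ _ => by positivity)
  have hvM : ∀ G : Finset (Fin 4 → ℤ), √(∑ z ∈ G, ‖v z‖ ^ 2) ≤ M := fun G => by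
    refine le_trans (Real.sqrt_le_sqrt (Finset.sum_le_sum fun x _ => ?_)) (hφM G)
    exact pow_le_pow_left₀ (norm_nonneg _) (hvφ x) 2
  have hsum : ∀ F : Finset (Fin 4 → ℤ), ∑ x ∈ F, ‖φ x‖ ^ 2 ≤ 1 / 2 * (M * M) := by
    intro F
    have hle : ∀ N : ℕ, ‖∑ x ∈ F, starRingEnd ℂ (φ x) * w x * (s * Complex.I
        * propagatorIntegral 4 s ν 0 (2 ^ N) (R g) x)‖ ≤ 1 / 2 * (M * M) := by
      intro N
      have h := hmain s ν R hs hsν hRn hRc w ε hw0 hε0.le hwσ (fun x => starRingEnd ℂ (φ x)) v g M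
        hgv hvM N F
      simp only [RCLike.norm_conj] at h
      have hre : ∑ x ∈ F, starRingEnd ℂ (φ x) * w x * (s * Complex.I
          * propagatorIntegral 4 s ν 0 (2 ^ N) (R g) x)
          = s * Complex.I * ∑ x ∈ F, starRingEnd ℂ (φ x) * w x
            * propagatorIntegral 4 s ν 0 (2 ^ N) (R g) x := by
        rw [Finset.mul_sum]
        exact Finset.sum_congr rfl fun x _ => by ring
      rw [hre, norm_mul, norm_mul, Complex.norm_real, Real.norm_eq_abs, hs, Complex.norm_I,
        one_mul, one_mul]
      refine h.trans ?_
      have hM0 : 0 ≤ M := Real.sqrt_nonneg _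
      have := hφM F
      gcongr
    have hl := (tendsto_finsetSum F fun x _ =>
      (hlim x).const_mul (starRingEnd ℂ (φ x) * w x)).norm
    have h := le_of_tendsto' hl hle
    have hid : ∑ x ∈ F, starRingEnd ℂ (φ x) * w x * -ψ x
        = ((-∑ x ∈ F, ‖φ x‖ ^ 2 : ℝ) : ℂ) := by
      rw [← Finset.sum_neg_distrib, Complex.ofReal_sum]
      refine Finset.sum_congr rfl fun x _ => ?_
      rw [Complex.ofReal_neg, Complex.ofReal_pow, ← Complex.conj_mul']
      simp only [φ]; ring
    rw [hid, Complex.norm_real, norm_neg, Real.norm_of_nonneg (by positivity)] at h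
    exact h
  have hMM : M * M = ∑' x, ‖φ x‖ ^ 2 :=
    Real.mul_self_sqrt (tsum_nonneg fun _ => by positivity)
  have hts : ∑' x, ‖φ x‖ ^ 2 ≤ 1 / 2 * (M * M) := hφs.tsum_le_of_sum_le hsum
  have hφ0 : ∀ x, φ x = 0 := fun x => by
    have h := hφs.le_tsum x fun _ _ => by positivity
    have h' : ‖φ x‖ ^ 2 ≤ 0 := by linarith
    simpa using le_antisymm h' (by positivity)
  have hg0 : g = 0 := by
    ext x
    rw [hgv]
    simp [v, hφ0]
  refine hψ0 ?_
  ext x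
  have h := hlim x
  rw [hg0] at h
  simp only [map_zero] at h
  have h0 : Tendsto (fun _ : ℕ => s * Complex.I * (0 : LatticeL2 4) x) atTop (𝓝 0) := by
    simp
  simpa using tendsto_nhds_unique h h0
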